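/- arXiv:2304.11429 — 3 statements merged into one kernel-verified Lean document; each statement's English description precedes it below -/
import Mathlib

section
/- For every natural number m ≥ 2 there exists a set R of 2m rays in the plane that are pairwise disjoint as subsets of ℝ², such that the total number of connected components of the Voronoi regions, summed over all r ∈ R, is at least (m − 1)²; in particular, the rotating rays Voronoi diagram of n pairwise non-intersecting rays can have Ω(n²) combinatorial complexity. -/
noncomputable section

open Real

abbrev Pt : Type := EuclideanSpace ℝ (Fin 2)

instance : Fact (Module.finrank ℝ Pt = 2) := ⟨finrank_euclideanSpace_fin⟩

noncomputable def stdOrient : Orientation ℝ Pt (Fin 2) :=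
  (EuclideanSpace.basisFun (Fin 2) ℝ).toBasis.orientation

/-- A ray in the plane, given by its apex and its direction vector. -/
structure Ray2 where
  apex : Pt
  dir : Pt

/-- The set of points of a ray. -/
def Ray2.carrier (r : Ray2) : Set Pt := {x | ∃ t : ℝ, 0 ≤ t ∧ x = r.apex + t • r.dir}

/-- The representative in `[0, 2π)` of an angle. -/
noncomputable def angleIco (θ : Real.Angle) : ℝ :=
  if 0 ≤ θ.toReal then θ.toReal else θ.toReal + 2 * π

open Classical in
/-- The counterclockwise angular distance from a point `x` to a ray `r`. -/
noncomputable def adist (x : Pt) (r : Ray2) : ℝ :=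
  if x = r.apex then 0 else angleIco (stdOrient.oangle r.dir (x - r.apex))

/-- The Voronoi region of a ray `r` in a finite set of rays `R`. -/
def rreg (R : Finset Ray2) (r : Ray2) : Set Pt :=
  {x | ∀ s ∈ R, s ≠ r → adist x r < adist x s}

/-- The rotating rays Voronoi diagram. -/
def RVD (R : Finset Ray2) : Set Pt :=
  (Set.univ \ ⋃ r ∈ R, rreg R r) ∪ ⋃ r ∈ R, r.carrier

/-- The point of the plane with the given coordinates. -/
noncomputable def pt (a b : ℝ) : Pt := (WithLp.equiv 2 (Fin 2 → ℝ)).symm ![a, b]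


/-- The vector from the apex of `r` to `x`, as a complex number in the frame of `r.dir`. -/
def Ray2.frame (r : Ray2) (x : Pt) : ℂ :=
  ⟨r.dir 0 * (x 0 - r.apex 0) + r.dir 1 * (x 1 - r.apex 1),
    r.dir 0 * (x 1 - r.apex 1) - r.dir 1 * (x 0 - r.apex 0)⟩

/-- The argument of a complex number, taken in `[0, 2π)`. -/
def turn (z : ℂ) : ℝ := if 0 ≤ z.arg then z.arg else z.arg + 2 * π

theorem stdOrient_areaForm (u v : Pt) : stdOrient.areaForm u v = u 0 * v 1 - u 1 * v 0 := by
  rw [Orientation.areaForm_to_volumeForm,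
    Orientation.volumeForm_robust stdOrient (EuclideanSpace.basisFun (Fin 2) ℝ) rfl]
  simp [Module.Basis.det_apply, Matrix.det_fin_two, Module.Basis.toMatrix_apply]
  ring

theorem adist_eq_turn (x : Pt) (r : Ray2) : adist x r = turn (r.frame x) := by
  have key : stdOrient.kahler r.dir (x - r.apex) = r.frame x := by
    rw [Orientation.kahler_apply_apply, stdOrient_areaForm]
    apply Complex.ext <;> simp [Ray2.frame, PiLp.inner_apply, Fin.sum_univ_two]; ring
  unfold adist
  split_ifs with h
  · have : r.frame x = 0 := by
      rw [← key, h]; simp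
    simp [turn, this]
  · simp [angleIco, Orientation.oangle, key, Complex.arg_coe_angle_toReal_eq_arg, turn]

theorem turn_nonneg (z : ℂ) : 0 ≤ turn z := by
  unfold turn
  split_ifs with h
  · exact h
  · linarith [Complex.neg_pi_lt_arg z, Real.pi_pos]

theorem turn_eq_arg {z : ℂ} (h : 0 ≤ z.im) : turn z = z.arg := by
  rw [turn, if_pos (Complex.arg_nonneg_iff.2 h)]

theorem turn_eq_arg_add {z : ℂ} (h : z.im < 0) : turn z = z.arg + 2 * π := by
  rw [turn, if_neg (not_le.2 (Complex.arg_neg_iff.2 h))]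

theorem cross_eq_sin (z w : ℂ) :
    z.re * w.im - z.im * w.re = ‖z‖ * ‖w‖ * Real.sin (w.arg - z.arg) := by
  rw [Real.sin_sub]
  conv_lhs => rw [← Complex.norm_mul_cos_arg z, ← Complex.norm_mul_sin_arg z,
    ← Complex.norm_mul_cos_arg w, ← Complex.norm_mul_sin_arg w]
  ring

theorem arg_lt_arg_iff {z w : ℂ} (hz : z ≠ 0) (hw : w ≠ 0) (h : w.arg - z.arg < π)
    (h' : -π < w.arg - z.arg) :
    z.arg < w.arg ↔ 0 < z.re * w.im - z.im * w.re := by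
  rw [cross_eq_sin, mul_pos_iff_of_pos_left (by positivity)]
  constructor
  · intro hlt
    exact Real.sin_pos_of_pos_of_lt_pi (by linarith) h
  · intro hs
    by_contra hle
    exact absurd (Real.sin_nonpos_of_nonpos_of_neg_pi_le (by linarith) h'.le) (not_le.2 hs)

theorem turn_lt_turn_of_im {z w : ℂ} (hz : 0 ≤ z.im) (hw : w.im < 0) : turn z < turn w := by
  rw [turn_eq_arg hz, turn_eq_arg_add hw]
  linarith [Complex.arg_le_pi z, Complex.neg_pi_lt_arg w]

theorem turn_lt_turn_of_cross {z w : ℂ} (hz : 0 < z.im) (hw : 0 < w.im)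
    (h : 0 < z.re * w.im - z.im * w.re) : turn z < turn w := by
  have hz0 : z ≠ 0 := by rintro rfl; simp at hz
  have hw0 : w ≠ 0 := by rintro rfl; simp at hw
  have h1 := Complex.arg_lt_pi_iff.2 (Or.inr hz.ne')
  have h2 := Complex.arg_lt_pi_iff.2 (Or.inr hw.ne')
  have h3 := Complex.arg_nonneg_iff.2 hz.le
  have h4 := Complex.arg_nonneg_iff.2 hw.le
  rw [turn_eq_arg hz.le, turn_eq_arg hw.le]
  exact (arg_lt_arg_iff hz0 hw0 (by linarith) (by linarith)).2 h

theorem turn_lt_turn_iff {z w : ℂ} (hz : z ≠ 0) :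
    turn z < turn w ↔ (0 ≤ z.im ∧ w.im < 0) ∨
      ((0 ≤ z.im ↔ 0 ≤ w.im) ∧ (0 < z.re * w.im - z.im * w.re ∨
        (z.im = 0 ∧ 0 < z.re ∧ w.im = 0 ∧ w.re < 0))) := by
  rcases lt_or_ge z.im 0 with hzi | hzi <;> rcases lt_or_ge w.im 0 with hwi | hwi
  · have hw0 : w ≠ 0 := by rintro rfl; simp at hwi
    have h1 := Complex.arg_neg_iff.2 hzi
    have h2 := Complex.arg_neg_iff.2 hwi
    have h3 := Complex.neg_pi_lt_arg z
    have h4 := Complex.neg_pi_lt_arg w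
    rw [turn_eq_arg_add hzi, turn_eq_arg_add hwi, add_lt_add_iff_right,
      arg_lt_arg_iff hz hw0 (by linarith) (by linarith)]
    simp [not_le.2 hzi, not_le.2 hwi, hzi.ne]
  · have := turn_lt_turn_of_im hwi hzi
    simp [not_le.2 hzi, not_lt.2 this.le, hwi]
  · simp [turn_lt_turn_of_im hzi hwi, hzi, hwi]
  · rw [turn_eq_arg hzi, turn_eq_arg hwi]
    simp only [hzi, hwi, not_lt.2 hwi, and_false, true_and, false_or]
    by_cases hw0 : w = 0
    · simp [hw0, hzi]
    have h1 := Complex.arg_nonneg_iff.2 hzi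
    have h2 := Complex.arg_nonneg_iff.2 hwi
    have h3 := Complex.arg_le_pi z
    have h4 := Complex.arg_le_pi w
    by_cases hx : w.arg = π ∧ z.arg = 0
    · have hw := Complex.arg_eq_pi_iff.1 hx.1
      have hz' := Complex.arg_eq_zero_iff.1 hx.2
      have : 0 < z.re := lt_of_le_of_ne hz'.1 fun h => hz (Complex.ext h.symm hz'.2)
      simp [hx.1, hx.2, Real.pi_pos, hw, hz', this]
    by_cases hy : z.arg = π ∧ w.arg = 0
    · have hz' := Complex.arg_eq_pi_iff.1 hy.1
      have hw := Complex.arg_eq_zero_iff.1 hy.2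
      simp [hy.1, hy.2, Real.pi_pos.le, hw, hz', not_lt.2 hz'.1.le]
    have h5 : w.arg - z.arg < π := by
      by_contra h
      exact hx ⟨by linarith, by linarith⟩
    have h6 : -π < w.arg - z.arg := by
      by_contra h
      exact hy ⟨by linarith, by linarith⟩
    rw [arg_lt_arg_iff hz hw0 h5 h6]
    constructor
    · exact Or.inl
    · rintro (h | ⟨hz1, hz2, hw1, hw2⟩)
      · exact h
      · exact absurd ⟨Complex.arg_eq_pi_iff.2 ⟨hw2, hw1⟩, Complex.arg_eq_zero_iff.2 ⟨hz2.le, hz1⟩⟩ hx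

/-- A set that is a union of finitely many preconnected sets. -/
def FinitelyPieced {X : Type*} [TopologicalSpace X] (A : Set X) : Prop :=
  ∃ 𝒞 : Set (Set X), 𝒞.Finite ∧ (∀ C ∈ 𝒞, IsPreconnected C) ∧ ⋃₀ 𝒞 = A

theorem IsPreconnected.finitelyPieced {X : Type*} [TopologicalSpace X] {A : Set X}
    (hA : IsPreconnected A) : FinitelyPieced A :=
  ⟨{A}, Set.finite_singleton A, by simpa using hA, Set.sUnion_singleton A⟩

theorem FinitelyPieced.union {X : Type*} [TopologicalSpace X] {A B : Set X}
    (hA : FinitelyPieced A) (hB : FinitelyPieced B) : FinitelyPieced (A ∪ B) := by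
  obtain ⟨𝒞, hfin, hpre, rfl⟩ := hA
  obtain ⟨𝒟, hfin', hpre', rfl⟩ := hB
  refine ⟨𝒞 ∪ 𝒟, hfin.union hfin', ?_, Set.sUnion_union 𝒞 𝒟⟩
  rintro C (hC | hC)
  exacts [hpre C hC, hpre' C hC]

theorem FinitelyPieced.image {X Y : Type*} [TopologicalSpace X] [TopologicalSpace Y] {A : Set X}
    (hA : FinitelyPieced A) {f : X → Y} (hf : Continuous f) : FinitelyPieced (f '' A) := by
  obtain ⟨𝒞, hfin, hpre, rfl⟩ := hA
  refine ⟨Set.image f '' 𝒞, hfin.image _, ?_, (Set.image_sUnion).symm⟩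
  rintro _ ⟨C, hC, rfl⟩
  exact (hpre C hC).image f hf.continuousOn

theorem FinitelyPieced.finite_connectedComponents {X : Type*} [TopologicalSpace X] {A : Set X}
    (hA : FinitelyPieced A) : Finite (ConnectedComponents A) := by
  classical
  obtain ⟨𝒞, hfin, hpre, hU⟩ := hA
  have : Finite 𝒞 := hfin
  have hpoint : ∀ C : {C : 𝒞 // (C : Set X).Nonempty}, ∃ a : A, (a : X) ∈ (C : Set X) := by
    rintro ⟨⟨C, hC⟩, x, hx⟩
    exact ⟨⟨x, hU ▸ ⟨C, hC, hx⟩⟩, hx⟩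
  choose a ha using hpoint
  refine Finite.of_surjective (fun C => (a C : ConnectedComponents A)) ?_
  intro q
  obtain ⟨⟨x, hx⟩, rfl⟩ := ConnectedComponents.surjective_coe q
  obtain ⟨C, hC, hxC⟩ : x ∈ ⋃₀ 𝒞 := hU ▸ hx
  refine ⟨⟨⟨C, hC⟩, x, hxC⟩, ?_⟩
  have hsub : C ⊆ A := hU ▸ Set.subset_sUnion_of_mem hC
  have hpre' : IsPreconnected ((↑) ⁻¹' C : Set A) := by
    rw [← Topology.IsInducing.subtypeVal.isPreconnected_image, Subtype.image_preimage_coe,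
      Set.inter_eq_right.2 hsub]
    exact hpre C hC
  rw [ConnectedComponents.coe_eq_coe']
  exact hpre'.subset_connectedComponent hxC (ha ⟨⟨C, hC⟩, x, hxC⟩)

/-- A set fibred over a preconnected base, with preconnected nonempty fibres and a local continuous
section through every point, is preconnected. -/
theorem isPreconnected_of_fibers {I : Set ℝ} (hI : IsPreconnected I) {E : Set (ℝ × ℝ)}
    (hbase : ∀ p ∈ E, p.1 ∈ I) (hne : ∀ t ∈ I, ∃ ρ, (t, ρ) ∈ E)
    (hfib : ∀ t ∈ I, IsPreconnected {ρ | (t, ρ) ∈ E})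
    (hsec : ∀ p ∈ E, ∃ s : ℝ → ℝ, ContinuousWithinAt s I p.1 ∧ s p.1 = p.2 ∧
      ∀ᶠ t in nhdsWithin p.1 I, (t, s t) ∈ E) : IsPreconnected E := by
  classical
  refine isPreconnected_of_forall_constant fun f hf => ?_
  have hconst : ∀ t ∈ I, ∀ ρ ρ', (t, ρ) ∈ E → (t, ρ') ∈ E → f (t, ρ) = f (t, ρ') := by
    intro t ht ρ ρ' h h'
    have hc : ContinuousOn (fun ρ => f (t, ρ)) {ρ | (t, ρ) ∈ E} :=
      hf.comp (by fun_prop) fun ρ hρ => hρ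
    exact (hfib t ht).constant hc h h'
  choose! σ hσ using hne
  have hg : ContinuousOn (fun t => f (t, σ t)) I := by
    intro t ht
    obtain ⟨s, hs, hst, hev⟩ := hsec _ (hσ t ht)
    have hmem : (t, s t) ∈ E := by
      have : (t, σ t) ∈ E := hσ t ht
      simpa [hst] using this
    have h1 : Filter.Tendsto (fun t' => (t', s t')) (nhdsWithin t I) (nhdsWithin (t, s t) E) :=
      tendsto_nhdsWithin_iff.2 ⟨(continuousWithinAt_id.prodMk hs), hev⟩
    have h2 := (hf _ hmem).tendsto.comp h1
    rw [hconst t ht _ _ hmem (hσ t ht)] at h2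
    refine h2.congr' ?_
    filter_upwards [hev, self_mem_nhdsWithin] with t' ht' htI
    exact hconst t' htI _ _ ht' (hσ t' htI)
  rintro ⟨t, ρ⟩ hp ⟨t', ρ'⟩ hp'
  have ht := hbase _ hp
  have ht' := hbase _ hp'
  rw [hconst t ht _ _ hp (hσ t ht), hconst t' ht' _ _ hp' (hσ t' ht')]
  exact hI.constant hg ht ht'

theorem ordConnected_sign_affine (a b : ℝ) (ε : SignType) :
    {ρ : ℝ | SignType.sign (a * ρ + b) = ε}.OrdConnected := by
  have hconv : Convex ℝ {ρ : ℝ | SignType.sign (a * ρ + b) = ε} := by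
    intro x hx y hy u v hu hv huv
    simp only [Set.mem_ofPred_eq] at hx hy ⊢
    have e : a * (u • x + v • y) + b = u * (a * x + b) + v * (a * y + b) := by
      simp only [smul_eq_mul]
      linear_combination (-b) * huv
    rw [e]
    have huv' : 0 < u ∨ 0 < v := by
      by_contra! h
      linarith
    cases ε
    · rw [SignType.zero_eq_zero, _root_.sign_eq_zero_iff] at hx hy ⊢
      rw [hx, hy]
      ring
    · simp only [SignType.neg_eq_neg_one, sign_eq_neg_one_iff] at hx hy ⊢
      rcases huv' with h | h <;> nlinarith
    · simp only [SignType.pos_eq_one, sign_eq_one_iff] at hx hy ⊢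
      rcases huv' with h | h
      · have := mul_pos h hx
        have := mul_nonneg hv hy.le
        linarith
      · have := mul_nonneg hu hx.le
        have := mul_pos h hy
        linarith
  exact hconv.ordConnected

theorem sign_affine_eq {a b ρ : ℝ} (ha : a ≠ 0) :
    SignType.sign (a * ρ + b) = SignType.sign a * SignType.sign (ρ - -b / a) := by
  rw [← sign_mul]
  congr 1
  field_simp
  ring

theorem neg_div_lt_neg_div_iff {a b a' b' : ℝ} (ha : a ≠ 0) (ha' : a' ≠ 0) :
    -b / a < -b' / a' ↔
      SignType.sign (a' * b - a * b') * (SignType.sign a' * SignType.sign a) = 1 := by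
  rw [← sign_mul, ← sign_mul, sign_eq_one_iff, ← sub_pos]
  have e : -b' / a' - -b / a = (a' * b - a * b') * (a' * a) / (a' * a) ^ 2 := by
    field_simp
    ring
  rw [e, div_pos_iff_of_pos_right (by positivity)]

/-- Over a preconnected set of parameters on which the coefficients and the pairwise resultants of
finitely many affine functions have constant sign, every sign condition cuts out a preconnected
set. -/
theorem isPreconnected_cell {ι : Type*} [Finite ι] {I : Set ℝ} (hI : IsPreconnected I)
    {a b : ι → ℝ → ℝ} (hca : ∀ l, Continuous (a l)) (hcb : ∀ l, Continuous (b l))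
    (hsa : ∀ l, ∀ t ∈ I, ∀ t' ∈ I, SignType.sign (a l t) = SignType.sign (a l t'))
    (hsb : ∀ l, ∀ t ∈ I, ∀ t' ∈ I, SignType.sign (b l t) = SignType.sign (b l t'))
    (hsD : ∀ l k, ∀ t ∈ I, ∀ t' ∈ I, SignType.sign (a l t * b k t - a k t * b l t) =
      SignType.sign (a l t' * b k t' - a k t' * b l t'))
    (ε : ι → SignType) :
    IsPreconnected {p : ℝ × ℝ | p.1 ∈ I ∧ ∀ l, SignType.sign (a l p.1 * p.2 + b l p.1) = ε l} := by
  classical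
  set E := {p : ℝ × ℝ | p.1 ∈ I ∧ ∀ l, SignType.sign (a l p.1 * p.2 + b l p.1) = ε l} with hE
  rcases Set.eq_empty_or_nonempty E with he | ⟨⟨t₀, ρ₀⟩, ht₀, hρ₀⟩
  · rw [he]
    exact isPreconnected_empty
  simp only at ht₀ hρ₀
  have hsa0 : ∀ l, ∀ t ∈ I, (a l t = 0 ↔ a l t₀ = 0) := fun l t ht => by
    rw [← _root_.sign_eq_zero_iff, hsa l t ht t₀ ht₀, _root_.sign_eq_zero_iff]
  have hsb0 : ∀ l, ∀ t ∈ I, (b l t = 0 ↔ b l t₀ = 0) := fun l t ht => by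
    rw [← _root_.sign_eq_zero_iff, hsb l t ht t₀ ht₀, _root_.sign_eq_zero_iff]
  by_cases hgraph : ∃ l, ε l = 0 ∧ a l t₀ ≠ 0
  · obtain ⟨l, hl, hal⟩ := hgraph
    have hne : ∀ t ∈ I, a l t ≠ 0 := fun t ht h => hal ((hsa0 l t ht).1 h)
    have huniq : ∀ p ∈ E, p.2 = -b l p.1 / a l p.1 := by
      rintro ⟨t, ρ⟩ ⟨ht, hρ⟩
      have := hρ l
      rw [hl, _root_.sign_eq_zero_iff] at this
      have := hne t ht
      simp only at *
      field_simp
      linarith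
    have hval : ∀ k, ∀ t ∈ I, SignType.sign (a k t * (-b l t / a l t) + b k t) =
        SignType.sign (a l t * b k t - a k t * b l t) * SignType.sign (a l t) := by
      intro k t ht
      have := hne t ht
      have e : a k t * (-b l t / a l t) + b k t =
          ((a l t * b k t - a k t * b l t) * a l t) * (a l t ^ 2)⁻¹ := by
        field_simp
        ring
      have hp : 0 < (a l t ^ 2)⁻¹ := by positivity
      rw [e, sign_mul, sign_mul, sign_pos hp, mul_one]
    have himg : E = (fun t => (t, -b l t / a l t)) '' I := by
      ext ⟨t, ρ⟩
      constructor
      · intro hp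
        have := huniq _ hp
        exact ⟨t, hp.1, by simp only at this; simp [this]⟩
      · rintro ⟨t', ht', h⟩
        obtain ⟨rfl, rfl⟩ := Prod.mk.inj h
        refine ⟨ht', fun k => ?_⟩
        have h0 := huniq (t₀, ρ₀) ⟨ht₀, hρ₀⟩
        simp only at h0 ⊢
        rw [hval k t' ht', hsD l k t' ht' t₀ ht₀, hsa l t' ht' t₀ ht₀, ← hval k t₀ ht₀, ← h0,
          hρ₀ k]
    rw [himg]
    refine hI.image _ (continuousOn_id.prodMk ?_)
    exact ((hcb l).neg.continuousOn).div (hca l).continuousOn hne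
  push Not at hgraph
  have hzero : ∀ l, ε l = 0 → ∀ t ∈ I, a l t = 0 ∧ b l t = 0 := by
    intro l hl t ht
    have h1 := hgraph l hl
    have h2 := hρ₀ l
    rw [h1, zero_mul, zero_add, hl, _root_.sign_eq_zero_iff] at h2
    exact ⟨(hsa0 l t ht).2 h1, (hsb0 l t ht).2 h2⟩
  refine isPreconnected_of_fibers hI (fun p hp => hp.1) ?_ ?_ ?_
  · intro t ht
    have := Fintype.ofFinite ι
    obtain ⟨ρ, hlo, hhi⟩ := Order.exists_between_finsets
      ((Finset.univ.filter fun l => a l t ≠ 0 ∧ ε l = SignType.sign (a l t)).image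
        fun l => -b l t / a l t)
      ((Finset.univ.filter fun l => a l t ≠ 0 ∧ ε l = -SignType.sign (a l t)).image
        fun l => -b l t / a l t) (by
        simp only [Finset.mem_image, Finset.mem_filter, Finset.mem_univ, true_and]
        rintro _ ⟨l, ⟨hl, hεl⟩, rfl⟩ _ ⟨k, ⟨hk, hεk⟩, rfl⟩
        have hl0 : a l t₀ ≠ 0 := fun h => hl ((hsa0 l t ht).2 h)
        have hk0 : a k t₀ ≠ 0 := fun h => hk ((hsa0 k t ht).2 h)
        rw [neg_div_lt_neg_div_iff hl hk, hsD k l t ht t₀ ht₀, hsa k t ht t₀ ht₀,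
          hsa l t ht t₀ ht₀, ← neg_div_lt_neg_div_iff hl0 hk0]
        have h1 := hρ₀ l
        have h2 := hρ₀ k
        rw [sign_affine_eq hl0, hεl, hsa l t ht t₀ ht₀] at h1
        rw [sign_affine_eq hk0, hεk, hsa k t ht t₀ ht₀] at h2
        have h3 : SignType.sign (ρ₀ - -b l t₀ / a l t₀) = 1 := by
          have := sign_ne_zero.2 hl0
          revert h1 this
          generalize SignType.sign (a l t₀) = u
          generalize SignType.sign (ρ₀ - -b l t₀ / a l t₀) = v
          revert u v
          decide
        have h4 : SignType.sign (ρ₀ - -b k t₀ / a k t₀) = -1 := by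
          have := sign_ne_zero.2 hk0
          revert h2 this
          generalize SignType.sign (a k t₀) = u
          generalize SignType.sign (ρ₀ - -b k t₀ / a k t₀) = v
          revert u v
          decide
        rw [sign_eq_one_iff] at h3
        rw [sign_eq_neg_one_iff] at h4
        linarith)
    simp only [Finset.mem_image, Finset.mem_filter, Finset.mem_univ, true_and,
      forall_exists_index, and_imp] at hlo hhi
    refine ⟨ρ, ht, fun l => ?_⟩
    simp only
    by_cases hl : a l t = 0
    · rw [hl, zero_mul, zero_add, hsb l t ht t₀ ht₀, ← hρ₀ l, (hsa0 l t ht).1 hl, zero_mul,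
        zero_add]
    have hεl : ε l ≠ 0 := fun h => hl (hzero l h t ht).1
    have hcases : ε l = SignType.sign (a l t) ∨ ε l = -SignType.sign (a l t) := by
      have := sign_ne_zero.2 hl
      revert hεl this
      generalize SignType.sign (a l t) = u
      generalize ε l = v
      revert u v
      decide
    rw [sign_affine_eq hl]
    rcases hcases with h | h
    · rw [sign_pos (sub_pos.2 (hlo _ l hl h rfl)), mul_one, h]
    · rw [sign_neg (sub_neg.2 (hhi _ l hl h rfl)), h, mul_neg_one]
  · intro t ht
    have e : {ρ | (t, ρ) ∈ E} = ⋂ l, {ρ | SignType.sign (a l t * ρ + b l t) = ε l} := by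
      ext ρ
      simp [hE, ht]
    rw [e]
    exact (Set.ordConnected_iInter fun l => ordConnected_sign_affine _ _ _).isPreconnected
  · rintro ⟨t, ρ⟩ ⟨ht, hρ⟩
    refine ⟨fun _ => ρ, continuousWithinAt_const, rfl, ?_⟩
    have hall : ∀ᶠ t' in nhdsWithin t I, ∀ l, SignType.sign (a l t' * ρ + b l t') = ε l := by
      rw [Filter.eventually_all]
      intro l
      by_cases hl : ε l = 0
      · filter_upwards [self_mem_nhdsWithin] with t' ht'
        obtain ⟨h1, h2⟩ := hzero l hl t' ht'
        simp [h1, h2, hl]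
      · have h1 : a l t * ρ + b l t ≠ 0 := by
          intro h
          exact hl (by rw [← hρ l]; simp [h])
        have hc : ContinuousAt (fun t' => SignType.sign (a l t' * ρ + b l t')) t :=
          (continuousAt_sign_of_ne_zero h1).comp
            (f := fun t' => a l t' * ρ + b l t') (by have := hca l; have := hcb l; fun_prop)
        have := hc.preimage_mem_nhds ((isOpen_discrete {ε l}).mem_nhds (hρ l))
        exact nhdsWithin_le_nhds this
    filter_upwards [hall, self_mem_nhdsWithin] with t' h1 h2
    exact ⟨h2, h1⟩

theorem Polynomial.sign_eval_eq_of_ordConnected {P : Polynomial ℝ} {I : Set ℝ}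
    (hI : I.OrdConnected) (hP : P ≠ 0 → ∀ z ∈ I, P.eval z = 0 → ∀ t ∈ I, t = z) {t t' : ℝ}
    (ht : t ∈ I) (ht' : t' ∈ I) : SignType.sign (P.eval t) = SignType.sign (P.eval t') := by
  by_cases h0 : P = 0
  · simp [h0]
  by_cases hz : ∃ z ∈ I, P.eval z = 0
  · obtain ⟨z, hz, hPz⟩ := hz
    rw [hP h0 z hz hPz t ht, hP h0 z hz hPz t' ht']
  push Not at hz
  have hc : ContinuousOn (fun t => SignType.sign (P.eval t)) I := fun s hs =>
    ((continuousAt_sign_of_ne_zero (hz s hs)).comp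
      (f := fun t => P.eval t) P.continuous.continuousAt).continuousWithinAt
  exact hI.isPreconnected.constant hc ht ht'

/-- A set of pairs `(t, ρ)` whose membership depends only on the signs of finitely many functions
affine in `ρ` with coefficients polynomial in `t` is a finite union of preconnected sets. -/
theorem finitelyPieced_of_sign {ι : Type*} [Finite ι] (a b : ι → Polynomial ℝ) (A : Set (ℝ × ℝ))
    (hA : ∀ p p' : ℝ × ℝ, (∀ l, SignType.sign ((a l).eval p.1 * p.2 + (b l).eval p.1) =
      SignType.sign ((a l).eval p'.1 * p'.2 + (b l).eval p'.1)) → p ∈ A → p' ∈ A) :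
    FinitelyPieced A := by
  classical
  have := Fintype.ofFinite ι
  let P : ι ⊕ ι ⊕ ι × ι → Polynomial ℝ :=
    Sum.elim a (Sum.elim b fun q => a q.1 * b q.2 - a q.2 * b q.1)
  let Z : Finset ℝ := Finset.univ.biUnion fun k => (P k).roots.toFinset
  have hZ : ∀ k z, P k ≠ 0 → (P k).eval z = 0 → z ∈ Z := fun k z hk hz =>
    Finset.mem_biUnion.2 ⟨k, Finset.mem_univ k, by simp [hk, hz]⟩
  let I : (Z → SignType) → Set ℝ := fun τ => {t | ∀ z : Z, SignType.sign (t - z) = τ z}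
  have hI : ∀ τ, (I τ).OrdConnected := by
    intro τ
    have e : I τ = ⋂ z : Z, {t : ℝ | SignType.sign (1 * t + -(z : ℝ)) = τ z} := by
      ext t
      simp [I, sub_eq_add_neg]
    rw [e]
    exact Set.ordConnected_iInter fun z => ordConnected_sign_affine _ _ _
  have hsign : ∀ k τ, ∀ t ∈ I τ, ∀ t' ∈ I τ,
      SignType.sign ((P k).eval t) = SignType.sign ((P k).eval t') := by
    intro k τ t ht t' ht'
    refine Polynomial.sign_eval_eq_of_ordConnected (hI τ) ?_ ht ht'
    intro hk z hz hPz s hs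
    have h1 := hz ⟨z, hZ k z hk hPz⟩
    have h2 := hs ⟨z, hZ k z hk hPz⟩
    rw [← h1] at h2
    simpa [sub_eq_zero] using h2
  let cell : (Z → SignType) × (ι → SignType) → Set (ℝ × ℝ) := fun q => {p | p.1 ∈ I q.1 ∧
    ∀ l, SignType.sign ((a l).eval p.1 * p.2 + (b l).eval p.1) = q.2 l}
  have hcell : ∀ q, IsPreconnected (cell q) := fun q =>
    isPreconnected_cell (hI q.1).isPreconnected (fun l => (a l).continuous)
      (fun l => (b l).continuous) (fun l => hsign (Sum.inl l) q.1)
      (fun l => hsign (Sum.inr (Sum.inl l)) q.1)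
      (fun l k t ht t' ht' => by
        simpa [P] using hsign (Sum.inr (Sum.inr (l, k))) q.1 t ht t' ht') q.2
  refine ⟨cell '' {q | (cell q ∩ A).Nonempty}, (Set.toFinite _).image _, ?_, ?_⟩
  · rintro _ ⟨q, -, rfl⟩
    exact hcell q
  · ext p
    constructor
    · rintro ⟨_, ⟨q, ⟨p', hp', hpA⟩, rfl⟩, hp⟩
      exact hA p' p (fun l => (hp'.2 l).trans (hp.2 l).symm) hpA
    · intro hp
      exact ⟨_, ⟨(fun z => SignType.sign (p.1 - z),
        fun l => SignType.sign ((a l).eval p.1 * p.2 + (b l).eval p.1)),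
        ⟨p, ⟨fun _ => rfl, fun _ => rfl⟩, hp⟩, rfl⟩, ⟨fun _ => rfl, fun _ => rfl⟩⟩

theorem pos_iff_of_sign_eq {x y : ℝ} (h : SignType.sign x = SignType.sign y) : 0 < x ↔ 0 < y := by
  rw [← sign_eq_one_iff, h, sign_eq_one_iff]

theorem neg_iff_of_sign_eq {x y : ℝ} (h : SignType.sign x = SignType.sign y) : x < 0 ↔ y < 0 := by
  rw [← sign_eq_neg_one_iff, h, sign_eq_neg_one_iff]

theorem zero_iff_of_sign_eq {x y : ℝ} (h : SignType.sign x = SignType.sign y) : x = 0 ↔ y = 0 := by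
  rw [← _root_.sign_eq_zero_iff, h, _root_.sign_eq_zero_iff]

theorem turn_lt_turn_congr {z w z' w' : ℂ} (hz : z ≠ 0) (hz' : z' ≠ 0)
    (h1 : SignType.sign z.re = SignType.sign z'.re) (h2 : SignType.sign z.im = SignType.sign z'.im)
    (h3 : SignType.sign w.re = SignType.sign w'.re) (h4 : SignType.sign w.im = SignType.sign w'.im)
    (h5 : SignType.sign (z.re * w.im - z.im * w.re) =
      SignType.sign (z'.re * w'.im - z'.im * w'.re)) :
    turn z < turn w ↔ turn z' < turn w' := by
  rw [turn_lt_turn_iff hz, turn_lt_turn_iff hz', ← not_lt, ← not_lt, ← not_lt, ← not_lt,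
    pos_iff_of_sign_eq h1, neg_iff_of_sign_eq h2, neg_iff_of_sign_eq h3, neg_iff_of_sign_eq h4,
    pos_iff_of_sign_eq h5, zero_iff_of_sign_eq h2, zero_iff_of_sign_eq h4]

theorem Ray2.frame_eq_zero {r : Ray2} (hr : r.dir ≠ 0) {x : Pt} (h : r.frame x = 0) :
    x = r.apex := by
  have hre : r.dir 0 * (x 0 - r.apex 0) + r.dir 1 * (x 1 - r.apex 1) = 0 := congrArg Complex.re h
  have him : r.dir 0 * (x 1 - r.apex 1) - r.dir 1 * (x 0 - r.apex 0) = 0 := congrArg Complex.im h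
  have hpos : r.dir 0 ^ 2 + r.dir 1 ^ 2 ≠ 0 := by
    intro h0
    apply hr
    have h1 : r.dir 0 = 0 := by nlinarith [sq_nonneg (r.dir 0), sq_nonneg (r.dir 1)]
    have h2 : r.dir 1 = 0 := by nlinarith [sq_nonneg (r.dir 0), sq_nonneg (r.dir 1)]
    ext i
    fin_cases i <;> simpa
  have e0 : (r.dir 0 ^ 2 + r.dir 1 ^ 2) * (x 0 - r.apex 0) = 0 := by
    linear_combination r.dir 0 * hre - r.dir 1 * him
  have e1 : (r.dir 0 ^ 2 + r.dir 1 ^ 2) * (x 1 - r.apex 1) = 0 := by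
    linear_combination r.dir 1 * hre + r.dir 0 * him
  ext i
  fin_cases i
  · simpa [hpos, sub_eq_zero] using e0
  · simpa [hpos, sub_eq_zero] using e1

/-- The point at signed distance `p.2` from `q` in the direction `(e₀, e₁)` evaluated at `p.1`. -/
def pencil (q : Pt) (e₀ e₁ : Polynomial ℝ) (p : ℝ × ℝ) : Pt :=
  !₂[q 0 + p.2 * e₀.eval p.1, q 1 + p.2 * e₁.eval p.1]

theorem continuous_pencil (q : Pt) (e₀ e₁ : Polynomial ℝ) : Continuous (pencil q e₀ e₁) := by
  have h0 := e₀.continuous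
  have h1 := e₁.continuous
  refine (PiLp.continuous_toLp 2 _).comp (continuous_pi fun i => ?_)
  fin_cases i <;> simp <;> fun_prop

open Polynomial in
theorem finitelyPieced_pencil_rreg {R : Finset Ray2} {r : Ray2} (hrR : r ∈ R) (hr : r.dir ≠ 0)
    {e₀ e₁ : Polynomial ℝ} (he : ∀ t, e₀.eval t ≠ 0 ∨ e₁.eval t ≠ 0) :
    FinitelyPieced {p : ℝ × ℝ | p.2 ≠ 0 ∧ pencil r.apex e₀ e₁ p ∈ rreg R r} := by
  let alongCoeff : Ray2 → ℝ[X] := fun s => C (s.dir 0) * e₀ + C (s.dir 1) * e₁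
  let acrossCoeff : Ray2 → ℝ[X] := fun s => C (s.dir 0) * e₁ - C (s.dir 1) * e₀
  let along : Ray2 → ℝ[X] := fun s => C (s.frame r.apex).re
  let across : Ray2 → ℝ[X] := fun s => C (s.frame r.apex).im
  let a : Option (R × Fin 3) → ℝ[X] := fun l => l.elim 1 fun q =>
    ![alongCoeff q.1, acrossCoeff q.1,
      alongCoeff r * acrossCoeff q.1 - acrossCoeff r * alongCoeff q.1] q.2
  let b : Option (R × Fin 3) → ℝ[X] := fun l => l.elim 0 fun q =>
    ![along q.1, across q.1, alongCoeff r * across q.1 - acrossCoeff r * along q.1] q.2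
  have hre : ∀ (s : R) p, (s.1.frame (pencil r.apex e₀ e₁ p)).re =
      (a (some (s, 0))).eval p.1 * p.2 + (b (some (s, 0))).eval p.1 := by
    intro s p
    simp [a, b, alongCoeff, along, Ray2.frame, pencil]
    ring
  have him : ∀ (s : R) p, (s.1.frame (pencil r.apex e₀ e₁ p)).im =
      (a (some (s, 1))).eval p.1 * p.2 + (b (some (s, 1))).eval p.1 := by
    intro s p
    simp [a, b, acrossCoeff, across, Ray2.frame, pencil]
    ring
  have hcross : ∀ (s : R) p, (r.frame (pencil r.apex e₀ e₁ p)).re *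
      (s.1.frame (pencil r.apex e₀ e₁ p)).im - (r.frame (pencil r.apex e₀ e₁ p)).im *
      (s.1.frame (pencil r.apex e₀ e₁ p)).re =
      ((a none).eval p.1 * p.2 + (b none).eval p.1) *
      ((a (some (s, 2))).eval p.1 * p.2 + (b (some (s, 2))).eval p.1) := by
    intro s p
    simp [a, b, alongCoeff, acrossCoeff, along, across, Ray2.frame, pencil]
    ring
  have hne : ∀ p : ℝ × ℝ, p.2 ≠ 0 → r.frame (pencil r.apex e₀ e₁ p) ≠ 0 := by
    intro p hp h
    have hx := Ray2.frame_eq_zero hr h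
    have h0 := congrArg (fun x : Pt => x 0) hx
    have h1 := congrArg (fun x : Pt => x 1) hx
    simp [pencil, hp] at h0 h1
    rcases he p.1 with h | h
    exacts [h h0, h h1]
  refine finitelyPieced_of_sign a b _ ?_
  rintro p p' hpp ⟨hp, hmem⟩
  have hp' : p'.2 ≠ 0 := by
    have := hpp none
    simp only [a, b, Option.elim_none, eval_one, eval_zero, one_mul, add_zero] at this
    exact (zero_iff_of_sign_eq this).not.1 hp
  refine ⟨hp', fun s hs hsr => ?_⟩
  have := hmem s hs hsr
  rw [adist_eq_turn, adist_eq_turn] at this ⊢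
  refine (turn_lt_turn_congr (hne p hp) (hne p' hp') ?_ ?_ ?_ ?_ ?_).1 this
  · rw [hre ⟨r, hrR⟩, hre ⟨r, hrR⟩, hpp]
  · rw [him ⟨r, hrR⟩, him ⟨r, hrR⟩, hpp]
  · rw [hre ⟨s, hs⟩, hre ⟨s, hs⟩, hpp]
  · rw [him ⟨s, hs⟩, him ⟨s, hs⟩, hpp]
  · rw [hcross ⟨s, hs⟩, hcross ⟨s, hs⟩, sign_mul, sign_mul, hpp none, hpp]

theorem finitelyPieced_rreg {R : Finset Ray2} {r : Ray2} (hrR : r ∈ R) (hr : r.dir ≠ 0) :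
    FinitelyPieced (rreg R r) := by
  have h1 := (finitelyPieced_pencil_rreg hrR hr (e₀ := Polynomial.X) (e₁ := 1)
    (by simp)).image (continuous_pencil r.apex Polynomial.X 1)
  have h2 := (finitelyPieced_pencil_rreg hrR hr (e₀ := 1) (e₁ := 0)
    (by simp)).image (continuous_pencil r.apex 1 0)
  have h3 : FinitelyPieced ({r.apex} ∩ rreg R r) :=
    (Set.subsingleton_singleton.anti Set.inter_subset_left).isPreconnected.finitelyPieced
  convert (h1.union h2).union h3
  apply Set.Subset.antisymm
  · intro x hx
    by_cases hy : x 1 = r.apex 1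
    · by_cases hx0 : x 0 = r.apex 0
      · refine Or.inr ⟨?_, hx⟩
        ext i
        fin_cases i
        exacts [hx0, hy]
      · have e : pencil r.apex 1 0 (0, x 0 - r.apex 0) = x := by
          ext i
          fin_cases i <;> simp [pencil, hy]
        exact Or.inl (Or.inr ⟨_, ⟨sub_ne_zero.2 hx0, by rwa [e]⟩, e⟩)
    · have hne : x 1 - r.apex 1 ≠ 0 := sub_ne_zero.2 hy
      have e : pencil r.apex Polynomial.X 1
          ((x 0 - r.apex 0) / (x 1 - r.apex 1), x 1 - r.apex 1) = x := by
        ext i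
        fin_cases i
        · simp [pencil, mul_div_cancel₀ _ hne]
        · simp [pencil]
      exact Or.inl (Or.inl ⟨_, ⟨hne, by rwa [e]⟩, e⟩)
  · rintro x ((⟨p, hp, rfl⟩ | ⟨p, hp, rfl⟩) | hx)
    exacts [hp.2, hp.2, hx.2]

/-- The slope of the line from the origin to the apex of the `i`-th horizontal ray. -/
def apexSlope (m i : ℕ) : ℝ := (i + 1) / (m + 1)

/-- The average of `apexSlope m i` and `apexSlope m (i + 1)`. -/
def midSlope (m i : ℕ) : ℝ := (2 * i + 3) / (2 * (m + 1))

/-- The apices of the horizontal rays lie on the circle through the origin with diameter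
`2 - defect m ε` centred on the `x`-axis. -/
def defect (m : ℕ) (ε : ℝ) : ℝ := ε * (2 * m + m ^ 2)

/-- The `x`-coordinate of the apex of the `i`-th horizontal ray. -/
def abscissa (m : ℕ) (ε : ℝ) (i : ℕ) : ℝ := (2 - defect m ε) / (1 + apexSlope m i ^ 2)

/-- The `y`-coordinate of the apex of the `i`-th horizontal ray. -/
def height (m : ℕ) (ε : ℝ) (i : ℕ) : ℝ := apexSlope m i * abscissa m ε i

/-- The horizontal ray to the right from `(abscissa m ε i, height m ε i)`. -/
def horizontalRay (m : ℕ) (ε : ℝ) (i : ℕ) : Ray2 :=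
  ⟨pt (abscissa m ε i) (height m ε i), pt 1 0⟩

/-- The ray of slope `-j` on a line through the origin whose apex is the foot of the
perpendicular from `(2 + ε * j ^ 2, 0)`. -/
def slantedRay (ε : ℝ) (j : ℕ) : Ray2 :=
  ⟨pt ((2 + ε * j ^ 2) / (1 + j ^ 2)) (-j * ((2 + ε * j ^ 2) / (1 + j ^ 2))), pt 1 (-j)⟩

/-- The `x`-coordinate of `witness`. -/
def witnessAbscissa (m : ℕ) (ε : ℝ) (i j : ℕ) : ℝ :=
  (2 - ε * (2 * j * midSlope m i + j ^ 2)) / (1 + midSlope m i ^ 2)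

/-- A point of the region of the `j`-th slanted ray between the heights of the horizontal rays
`i` and `i + 1`. -/
def witness (m : ℕ) (ε : ℝ) (i j : ℕ) : Pt :=
  pt (witnessAbscissa m ε i j) (midSlope m i * witnessAbscissa m ε i j)

theorem horizontalRay_frame (m : ℕ) (ε : ℝ) (i : ℕ) (x : Pt) :
    (horizontalRay m ε i).frame x = ⟨x 0 - abscissa m ε i, x 1 - height m ε i⟩ := by
  simp [horizontalRay, Ray2.frame, pt]

theorem slantedRay_frame (ε : ℝ) (j : ℕ) (x : Pt) :
    (slantedRay ε j).frame x = ⟨x 0 - j * x 1 - (2 + ε * j ^ 2), x 1 + j * x 0⟩ := by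
  have h : (1 + (j : ℝ) ^ 2) ≠ 0 := by positivity
  apply Complex.ext
  · simp [slantedRay, Ray2.frame, pt]
    field_simp
    ring
  · simp [slantedRay, Ray2.frame, pt]
    ring

theorem snd_eq_of_mem_horizontalRay {m : ℕ} {ε : ℝ} {i : ℕ} {x : Pt}
    (hx : x ∈ (horizontalRay m ε i).carrier) : x 1 = height m ε i := by
  obtain ⟨t, -, rfl⟩ := hx
  simp [horizontalRay, pt]

theorem fst_pos_of_mem_slantedRay {ε : ℝ} (hε : 0 < ε) {j : ℕ} {x : Pt}
    (hx : x ∈ (slantedRay ε j).carrier) : 0 < x 0 ∧ x 1 = -j * x 0 := by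
  obtain ⟨t, ht, rfl⟩ := hx
  have : 0 < (2 + ε * j ^ 2) / (1 + (j : ℝ) ^ 2) := by positivity
  simp [slantedRay, pt]
  constructor
  · linarith
  · ring

theorem apexSlope_pos (m i : ℕ) : 0 < apexSlope m i := by unfold apexSlope; positivity

theorem apexSlope_lt_one {m i : ℕ} (h : i < m) : apexSlope m i < 1 := by
  rw [apexSlope, div_lt_one (by positivity)]
  exact_mod_cast Nat.succ_lt_succ h

theorem apexSlope_strictMono (m : ℕ) : StrictMono (apexSlope m) := by
  intro i j h
  unfold apexSlope
  gcongr

theorem apexSlope_lt_midSlope (m i : ℕ) : apexSlope m i < midSlope m i := by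
  rw [apexSlope, midSlope, div_lt_div_iff₀ (by positivity) (by positivity)]
  nlinarith [(m.cast_nonneg : (0 : ℝ) ≤ m)]

theorem midSlope_lt_apexSlope_succ (m i : ℕ) : midSlope m i < apexSlope m (i + 1) := by
  rw [apexSlope, midSlope, div_lt_div_iff₀ (by positivity) (by positivity)]
  push_cast
  nlinarith [(m.cast_nonneg : (0 : ℝ) ≤ m)]

theorem midSlope_pos (m i : ℕ) : 0 < midSlope m i :=
  (apexSlope_pos m i).trans (apexSlope_lt_midSlope m i)

theorem midSlope_lt_one {m i : ℕ} (h : i + 1 < m) : midSlope m i < 1 :=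
  (midSlope_lt_apexSlope_succ m i).trans (apexSlope_lt_one h)

theorem div_one_add_sq_lt {x y : ℝ} (hx : 0 < x) (hxy : x < y) (hy : y < 1) :
    x * (2 / (1 + x ^ 2)) < y * (2 / (1 + y ^ 2)) := by
  rw [mul_div_assoc', mul_div_assoc', div_lt_div_iff₀ (by positivity) (by positivity)]
  nlinarith [mul_pos (sub_pos.2 hxy) (sub_pos.2 (show x * y < 1 by nlinarith))]

theorem one_lt_two_div {x : ℝ} (hx : 0 < x) (hx1 : x < 1) : 1 < 2 / (1 + x ^ 2) := by
  rw [lt_div_iff₀ (by positivity)]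
  nlinarith

theorem mul_two_div_lt_one {x : ℝ} (hx : x < 1) : x * (2 / (1 + x ^ 2)) < 1 := by
  rw [mul_div_assoc', div_lt_one (by positivity)]
  nlinarith [sq_pos_of_pos (sub_pos.2 hx)]

/-- The inequalities of the construction that hold for all small `ε > 0`. -/
structure IsSmall (m : ℕ) (ε : ℝ) : Prop where
  pos : 0 < ε
  one_lt_abscissa : ∀ i < m, 1 < abscissa m ε i
  height_sq_lt : ∀ i < m, height m ε i ^ 2 < 1 - defect m ε
  one_lt_witness : ∀ i < m - 1, ∀ j < m, 1 < witnessAbscissa m ε i j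
  height_lt_witness : ∀ i < m - 1, ∀ j < m,
    height m ε i < midSlope m i * witnessAbscissa m ε i j
  witness_lt_height : ∀ i < m - 1, ∀ j < m,
    midSlope m i * witnessAbscissa m ε i j < height m ε (i + 1)
  cross_pos : ∀ i < m - 1, ∀ j < m, ∀ k ≤ i,
    0 < ((slantedRay ε j).frame (witness m ε i j)).re *
        ((horizontalRay m ε k).frame (witness m ε i j)).im -
      ((slantedRay ε j).frame (witness m ε i j)).im *
        ((horizontalRay m ε k).frame (witness m ε i j)).re

open Topology in
theorem eventually_pos_of_continuous {F : ℝ → ℝ} (hF : Continuous F) (h0 : 0 < F 0) :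
    ∀ᶠ ε in 𝓝[>] (0 : ℝ), 0 < F ε :=
  (hF.continuousAt.eventually (lt_mem_nhds h0)).filter_mono nhdsWithin_le_nhds

theorem continuous_abscissa (m i : ℕ) : Continuous fun ε => abscissa m ε i := by
  unfold abscissa defect
  fun_prop

theorem continuous_height (m i : ℕ) : Continuous fun ε => height m ε i :=
  (continuous_abscissa m i).const_mul _

theorem continuous_witnessAbscissa (m i j : ℕ) : Continuous fun ε => witnessAbscissa m ε i j := by
  unfold witnessAbscissa
  fun_prop

theorem cross_pos_zero {l μ j : ℝ} (hl : 0 < l) (hlμ : l < μ) (hj : 0 ≤ j) :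
    0 < (2 / (1 + μ ^ 2) - j * (μ * (2 / (1 + μ ^ 2))) - 2) *
        (μ * (2 / (1 + μ ^ 2)) - l * (2 / (1 + l ^ 2))) -
      (μ * (2 / (1 + μ ^ 2)) + j * (2 / (1 + μ ^ 2))) * (2 / (1 + μ ^ 2) - 2 / (1 + l ^ 2)) := by
  have : (2 / (1 + μ ^ 2) - j * (μ * (2 / (1 + μ ^ 2))) - 2) *
        (μ * (2 / (1 + μ ^ 2)) - l * (2 / (1 + l ^ 2))) -
      (μ * (2 / (1 + μ ^ 2)) + j * (2 / (1 + μ ^ 2))) * (2 / (1 + μ ^ 2) - 2 / (1 + l ^ 2)) =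
      (μ + j) * (2 / (1 + μ ^ 2)) * (2 * l * (μ - l) / (1 + l ^ 2)) := by
    field_simp
    ring
  rw [this]
  have := sub_pos.2 hlμ
  have := hl.trans hlμ
  positivity

open Topology in
theorem eventually_isSmall (m : ℕ) : ∀ᶠ ε in 𝓝[>] (0 : ℝ), IsSmall m ε := by
  have hc := continuous_abscissa m
  have hh := continuous_height m
  have hw := continuous_witnessAbscissa m
  have e1 : ∀ᶠ ε in 𝓝[>] (0 : ℝ), ∀ i ∈ Set.Iio m, 0 < abscissa m ε i - 1 := by
    refine (Set.finite_Iio m).eventually_all.2 fun i hi => ?_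
    refine eventually_pos_of_continuous (by fun_prop) ?_
    simpa [abscissa, defect] using one_lt_two_div (apexSlope_pos m i) (apexSlope_lt_one hi)
  have e2 : ∀ᶠ ε in 𝓝[>] (0 : ℝ), ∀ i ∈ Set.Iio m, 0 < 1 - defect m ε - height m ε i ^ 2 := by
    refine (Set.finite_Iio m).eventually_all.2 fun i hi => ?_
    refine eventually_pos_of_continuous (by unfold defect; fun_prop) ?_
    have h1 := mul_two_div_lt_one (apexSlope_lt_one hi)
    have h0 : 0 < apexSlope m i * (2 / (1 + apexSlope m i ^ 2)) :=
      mul_pos (apexSlope_pos m i) (by positivity)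
    simp only [height, abscissa, defect, zero_mul, sub_zero]
    nlinarith
  have e3 : ∀ᶠ ε in 𝓝[>] (0 : ℝ), ∀ i ∈ Set.Iio (m - 1), ∀ j ∈ Set.Iio m,
      0 < witnessAbscissa m ε i j - 1 := by
    refine (Set.finite_Iio _).eventually_all.2 fun i hi =>
      (Set.finite_Iio _).eventually_all.2 fun j hj => ?_
    refine eventually_pos_of_continuous (by fun_prop) ?_
    simpa [witnessAbscissa] using
      one_lt_two_div (midSlope_pos m i) (midSlope_lt_one (Nat.add_lt_of_lt_sub hi))
  have e4 : ∀ᶠ ε in 𝓝[>] (0 : ℝ), ∀ i ∈ Set.Iio (m - 1), ∀ j ∈ Set.Iio m,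
      0 < midSlope m i * witnessAbscissa m ε i j - height m ε i := by
    refine (Set.finite_Iio _).eventually_all.2 fun i hi =>
      (Set.finite_Iio _).eventually_all.2 fun j hj => ?_
    refine eventually_pos_of_continuous (by fun_prop) ?_
    simpa [witnessAbscissa, height, abscissa, defect] using div_one_add_sq_lt (apexSlope_pos m i)
      (apexSlope_lt_midSlope m i) (midSlope_lt_one (Nat.add_lt_of_lt_sub hi))
  have e5 : ∀ᶠ ε in 𝓝[>] (0 : ℝ), ∀ i ∈ Set.Iio (m - 1), ∀ j ∈ Set.Iio m,
      0 < height m ε (i + 1) - midSlope m i * witnessAbscissa m ε i j := by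
    refine (Set.finite_Iio _).eventually_all.2 fun i hi =>
      (Set.finite_Iio _).eventually_all.2 fun j hj => ?_
    refine eventually_pos_of_continuous (by fun_prop) ?_
    simpa [witnessAbscissa, height, abscissa, defect] using div_one_add_sq_lt (midSlope_pos m i)
      (midSlope_lt_apexSlope_succ m i) (apexSlope_lt_one (Nat.add_lt_of_lt_sub hi))
  have e6 : ∀ᶠ ε in 𝓝[>] (0 : ℝ), ∀ i ∈ Set.Iio (m - 1), ∀ j ∈ Set.Iio m, ∀ k ∈ Set.Iic i,
      0 < ((slantedRay ε j).frame (witness m ε i j)).re *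
          ((horizontalRay m ε k).frame (witness m ε i j)).im -
        ((slantedRay ε j).frame (witness m ε i j)).im *
          ((horizontalRay m ε k).frame (witness m ε i j)).re := by
    refine (Set.finite_Iio _).eventually_all.2 fun i hi =>
      (Set.finite_Iio _).eventually_all.2 fun j hj =>
      (Set.finite_Iic _).eventually_all.2 fun k hk => ?_
    simp only [slantedRay_frame, horizontalRay_frame]
    refine eventually_pos_of_continuous (by simp only [witness, pt]; simp; fun_prop) ?_
    simpa [witness, pt, witnessAbscissa, height, abscissa, defect] using
      cross_pos_zero (apexSlope_pos m k) (((apexSlope_strictMono m).monotone hk).trans_lt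
        (apexSlope_lt_midSlope m i)) j.cast_nonneg
  filter_upwards [e1, e2, e3, e4, e5, e6, self_mem_nhdsWithin] with ε h1 h2 h3 h4 h5 h6 h0
  exact ⟨h0, fun i hi => sub_pos.1 (h1 i hi), fun i hi => sub_pos.1 (h2 i hi),
    fun i hi j hj => sub_pos.1 (h3 i hi j hj), fun i hi j hj => sub_pos.1 (h4 i hi j hj),
    fun i hi j hj => sub_pos.1 (h5 i hi j hj), h6⟩

/-- The `m` horizontal rays and the `m` slanted rays. -/
def raySystem (m : ℕ) (ε : ℝ) : Fin m ⊕ Fin m → Ray2 :=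
  Sum.elim (fun i => horizontalRay m ε i) (fun j => slantedRay ε j)

theorem IsSmall.height_pos {m : ℕ} {ε : ℝ} (hε : IsSmall m ε) {i : ℕ} (hi : i < m) :
    0 < height m ε i :=
  mul_pos (apexSlope_pos m i) (one_pos.trans (hε.one_lt_abscissa i hi))

theorem IsSmall.defect_lt_one {m : ℕ} {ε : ℝ} (hε : IsSmall m ε) {i : ℕ} (hi : i < m) :
    defect m ε < 1 := by
  linarith [hε.height_sq_lt i hi, sq_nonneg (height m ε i)]

theorem IsSmall.height_lt_one {m : ℕ} {ε : ℝ} (hε : IsSmall m ε) {i : ℕ} (hi : i < m) :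
    height m ε i < 1 := by
  have : 0 ≤ defect m ε := mul_nonneg hε.pos.le (by positivity)
  nlinarith [hε.height_sq_lt i hi]

theorem IsSmall.height_lt_height {m : ℕ} {ε : ℝ} (hε : IsSmall m ε) {i j : ℕ} (hj : j < m)
    (hij : i < j) : height m ε i < height m ε j := by
  have h := div_one_add_sq_lt (apexSlope_pos m i) (apexSlope_strictMono m hij) (apexSlope_lt_one hj)
  have h2 : 0 < (2 - defect m ε) / 2 := by linarith [hε.defect_lt_one hj]
  have key : ∀ k, height m ε k =
      (2 - defect m ε) / 2 * (apexSlope m k * (2 / (1 + apexSlope m k ^ 2))) := by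
    intro k
    unfold height abscissa
    ring
  rw [key, key]
  exact mul_lt_mul_of_pos_left h h2

theorem IsSmall.height_le_height {m : ℕ} {ε : ℝ} (hε : IsSmall m ε) {i j : ℕ} (hj : j < m)
    (hij : i ≤ j) : height m ε i ≤ height m ε j :=
  hij.eq_or_lt.elim (fun h => by rw [h]) fun h => (hε.height_lt_height hj h).le

theorem height_injOn {m : ℕ} {ε : ℝ} (hε : IsSmall m ε) : Set.InjOn (height m ε) (Set.Iio m) :=
  StrictMonoOn.injOn fun _ _ _ hj hij => hε.height_lt_height hj hij

theorem abscissa_sq_add_height_sq (m : ℕ) (ε : ℝ) (i : ℕ) :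
    abscissa m ε i ^ 2 + height m ε i ^ 2 = (2 - defect m ε) * abscissa m ε i := by
  unfold height abscissa
  field_simp

theorem disjoint_raySystem {m : ℕ} {ε : ℝ} (hε : IsSmall m ε) {p q : Fin m ⊕ Fin m} (hpq : p ≠ q) :
    Disjoint (raySystem m ε p).carrier (raySystem m ε q).carrier := by
  rw [Set.disjoint_left]
  intro x hp hq
  rcases p with i | i <;> rcases q with j | j <;>
    simp only [raySystem, Sum.elim_inl, Sum.elim_inr] at hp hq
  · have := height_injOn hε i.2 j.2
      ((snd_eq_of_mem_horizontalRay hp).symm.trans (snd_eq_of_mem_horizontalRay hq))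
    exact hpq (congrArg _ (Fin.ext this))
  · have h1 := hε.height_pos i.2
    have h2 := fst_pos_of_mem_slantedRay hε.pos hq
    have h3 := snd_eq_of_mem_horizontalRay hp
    nlinarith [mul_nonneg (j : ℕ).cast_nonneg h2.1.le]
  · have h1 := hε.height_pos j.2
    have h2 := fst_pos_of_mem_slantedRay hε.pos hp
    have h3 := snd_eq_of_mem_horizontalRay hq
    nlinarith [mul_nonneg (i : ℕ).cast_nonneg h2.1.le]
  · have h1 := fst_pos_of_mem_slantedRay hε.pos hp
    have h2 := fst_pos_of_mem_slantedRay hε.pos hq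
    have h3 : ((i : ℕ) : ℝ) = (j : ℕ) := by
      have := h1.2.symm.trans h2.2
      simpa [h1.1.ne'] using this
    exact hpq (congrArg _ (Fin.ext (by exact_mod_cast h3)))

theorem Ray2.apex_mem_carrier (r : Ray2) : r.apex ∈ r.carrier := ⟨0, le_rfl, by simp⟩

theorem raySystem_injective {m : ℕ} {ε : ℝ} (hε : IsSmall m ε) :
    Function.Injective (raySystem m ε) := by
  intro p q h
  by_contra hpq
  have := Set.disjoint_left.1 (disjoint_raySystem hε hpq) (Ray2.apex_mem_carrier _)
  exact this (h ▸ Ray2.apex_mem_carrier _)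

theorem raySystem_dir_ne_zero (m : ℕ) (ε : ℝ) (p : Fin m ⊕ Fin m) : (raySystem m ε p).dir ≠ 0 := by
  intro h
  have := congrArg (fun x : Pt => x 0) h
  rcases p with i | i <;> simp [raySystem, horizontalRay, slantedRay, pt] at this

theorem mem_rreg_map {ι : Type*} [Fintype ι] (f : ι ↪ Ray2) (p : ι) (x : Pt) :
    x ∈ rreg (Finset.univ.map f) (f p) ↔ ∀ q, q ≠ p → adist x (f p) < adist x (f q) := by
  simp [rreg]

theorem slantedRay_cross (ε : ℝ) (j k : ℕ) (x : Pt) :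
    ((slantedRay ε j).frame x).re * ((slantedRay ε k).frame x).im -
      ((slantedRay ε j).frame x).im * ((slantedRay ε k).frame x).re =
    (k - j) * (x 0 ^ 2 + x 1 ^ 2 - 2 * x 0 + ε * ((j + k) * x 1 + j * k * x 0)) := by
  simp only [slantedRay_frame]
  ring

theorem witness_mem_rreg {m : ℕ} {ε : ℝ} (hε : IsSmall m ε) {i : ℕ} (hi : i < m - 1) (j : Fin m) :
    witness m ε i j ∈
      rreg (Finset.univ.map ⟨raySystem m ε, raySystem_injective hε⟩) (slantedRay ε j) := by
  have hX := hε.one_lt_witness i hi j j.2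
  have hμ := midSlope_pos m i
  have hX0 : witness m ε i j 0 = witnessAbscissa m ε i j := by simp [witness, pt]
  have hY0 : witness m ε i j 1 = midSlope m i * witnessAbscissa m ε i j := by simp [witness, pt]
  have him : ∀ k : ℕ, 0 < ((slantedRay ε k).frame (witness m ε i j)).im := by
    intro k
    rw [slantedRay_frame, hX0, hY0]
    positivity
  refine (mem_rreg_map ⟨raySystem m ε, raySystem_injective hε⟩ (Sum.inr j) _).2 ?_
  rintro (k | k) hk <;>
    simp only [Function.Embedding.coeFn_mk, raySystem, Sum.elim_inl, Sum.elim_inr, adist_eq_turn]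
  · rcases le_or_gt (k : ℕ) i with hki | hki
    · refine turn_lt_turn_of_cross (him j) ?_ (hε.cross_pos i hi j j.2 k hki)
      rw [horizontalRay_frame, hY0]
      exact sub_pos.2 ((hε.height_le_height (by omega) hki).trans_lt
        (hε.height_lt_witness i hi j j.2))
    · refine turn_lt_turn_of_im (him j).le ?_
      rw [horizontalRay_frame, hY0]
      exact sub_neg.2 ((hε.witness_lt_height i hi j j.2).trans_le (hε.height_le_height k.2 hki))
  · refine turn_lt_turn_of_cross (him j) (him k) ?_
    have hjk : ((k : ℕ) : ℝ) - (j : ℕ) ≠ 0 := by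
      rw [sub_ne_zero]
      exact fun h => hk (congrArg _ (Fin.ext (by exact_mod_cast h)))
    have hN : (1 + midSlope m i ^ 2) * witnessAbscissa m ε i j =
        2 - ε * (2 * j * midSlope m i + j ^ 2) := by
      unfold witnessAbscissa
      field_simp
    have hpos : 0 < ε * witnessAbscissa m ε i j * (((k : ℕ) : ℝ) - (j : ℕ)) ^ 2 *
        (midSlope m i + (j : ℕ)) := by
      have := hε.pos
      positivity
    rw [slantedRay_cross, hX0, hY0]
    convert hpos using 1
    linear_combination (((k : ℕ) : ℝ) - (j : ℕ)) * witnessAbscissa m ε i j * hN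

/-- An open set meeting, for each slanted ray except the last, its region in a clopen subset. -/
def strip (m : ℕ) (ε : ℝ) (i : ℕ) : Set Pt :=
  {x | height m ε i < x 1 ∧ x 1 < height m ε (i + 1) ∧ 1 < x 0 ∧ x 0 < 2 ∧
    (2 - defect m ε) * x 0 < x 0 ^ 2 + x 1 ^ 2}

/-- The closed counterpart of `strip`. -/
def closedStrip (m : ℕ) (ε : ℝ) (i : ℕ) : Set Pt :=
  {x | height m ε i ≤ x 1 ∧ x 1 ≤ height m ε (i + 1) ∧ 1 ≤ x 0 ∧ x 0 ≤ 2 ∧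
    (2 - defect m ε) * x 0 ≤ x 0 ^ 2 + x 1 ^ 2}

theorem isOpen_strip (m : ℕ) (ε : ℝ) (i : ℕ) : IsOpen (strip m ε i) := by
  refine .and (isOpen_lt ?_ ?_) (.and (isOpen_lt ?_ ?_) (.and (isOpen_lt ?_ ?_)
    (.and (isOpen_lt ?_ ?_) (isOpen_lt ?_ ?_)))) <;> fun_prop

theorem isClosed_closedStrip (m : ℕ) (ε : ℝ) (i : ℕ) : IsClosed (closedStrip m ε i) := by
  refine .and (isClosed_le ?_ ?_) (.and (isClosed_le ?_ ?_) (.and (isClosed_le ?_ ?_)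
    (.and (isClosed_le ?_ ?_) (isClosed_le ?_ ?_)))) <;> fun_prop

theorem strip_subset_closedStrip (m : ℕ) (ε : ℝ) (i : ℕ) : strip m ε i ⊆ closedStrip m ε i :=
  fun _ ⟨h1, h2, h3, h4, h5⟩ => ⟨h1.le, h2.le, h3.le, h4.le, h5.le⟩

theorem abscissa_le_of_mem_closedStrip {m : ℕ} {ε : ℝ} (hε : IsSmall m ε) {k : ℕ} (hk : k < m)
    {x : Pt} (hy : x 1 = height m ε k) (hx : 1 ≤ x 0)
    (hN : (2 - defect m ε) * x 0 ≤ x 0 ^ 2 + x 1 ^ 2) : abscissa m ε k ≤ x 0 := by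
  have hκ : 0 ≤ defect m ε := mul_nonneg hε.pos.le (by positivity)
  have h1 := abscissa_sq_add_height_sq m ε k
  have h2 := hε.one_lt_abscissa k hk
  rw [hy] at hN
  by_contra! h
  nlinarith [mul_pos (sub_pos.2 h) (show 0 < abscissa m ε k + x 0 - (2 - defect m ε) by linarith)]

theorem turn_eq_zero {z : ℂ} (h0 : 0 ≤ z.re) (h1 : z.im = 0) : turn z = 0 := by
  rw [turn_eq_arg h1.ge, Complex.arg_eq_zero_iff]
  exact ⟨h0, h1⟩

theorem mem_strip_of_mem_closedStrip {m : ℕ} {ε : ℝ} (hε : IsSmall m ε) {i : ℕ} (hi : i < m - 1)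
    {j : Fin m} (hj : (j : ℕ) < m - 1) {x : Pt}
    (hx : x ∈ rreg (Finset.univ.map ⟨raySystem m ε, raySystem_injective hε⟩) (slantedRay ε j))
    (hxi : x ∈ closedStrip m ε i) : x ∈ strip m ε i := by
  obtain ⟨h1, h2, h3, h4, h5⟩ := hxi
  have hlt := (mem_rreg_map ⟨raySystem m ε, raySystem_injective hε⟩ (Sum.inr j) _).1 hx
  have hH : ∀ k (hk : k < m),
      turn ((slantedRay ε j).frame x) < turn ((horizontalRay m ε k).frame x) := fun k hk => by
    simpa only [Function.Embedding.coeFn_mk, raySystem, Sum.elim_inl, Sum.elim_inr, adist_eq_turn]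
      using hlt (Sum.inl ⟨k, hk⟩) (by simp)
  have hS : ∀ k (hk : k < m), k ≠ j →
      turn ((slantedRay ε j).frame x) < turn ((slantedRay ε k).frame x) := fun k hk hkj => by
    simpa only [Function.Embedding.coeFn_mk, raySystem, Sum.elim_inl, Sum.elim_inr, adist_eq_turn]
      using hlt (Sum.inr ⟨k, hk⟩) (by simpa [Fin.ext_iff] using hkj)
  have hi0 := hε.height_pos (show i < m by omega)
  have hi1 := hε.height_lt_one (show i + 1 < m by omega)
  have hi2 := hε.height_sq_lt (i + 1) (by omega)
  have hκ : 0 ≤ defect m ε := mul_nonneg hε.pos.le (by positivity)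
  have hne : ∀ k < m, x 1 ≠ height m ε k := by
    intro k hk hy
    have hz : turn ((horizontalRay m ε k).frame x) = 0 := by
      rw [horizontalRay_frame]
      exact turn_eq_zero (sub_nonneg.2 (abscissa_le_of_mem_closedStrip hε hk hy h3 h5))
        (sub_eq_zero.2 hy)
    exact (turn_nonneg _).not_gt ((hH k hk).trans_eq hz)
  have hY := h1.lt_of_ne' (hne i (by omega))
  have him : ∀ k : ℕ, 0 < ((slantedRay ε k).frame x).im := by
    intro k
    rw [slantedRay_frame]
    have : 0 < x 1 := hi0.trans hY
    have : 0 < x 0 := by linarith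
    positivity
  refine ⟨hY, h2.lt_of_ne (hne _ (by omega)), h3.lt_of_ne ?_, h4.lt_of_ne ?_, h5.lt_of_ne ?_⟩
  · intro h
    rw [← h] at h5
    nlinarith
  · intro h
    have ha : abscissa m ε i < 2 := by
      rw [abscissa, div_lt_iff₀ (by positivity)]
      nlinarith [apexSlope_pos m i]
    refine lt_asymm (hH i (by omega)) (turn_lt_turn_of_cross ?_ (him j) ?_)
    · rw [horizontalRay_frame]
      exact sub_pos.2 hY
    · have hd := him j
      rw [slantedRay_frame] at hd
      rw [slantedRay_frame, horizontalRay_frame, h] at *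
      have hc : 0 ≤ (j : ℕ) * x 1 + ε * (j : ℕ) ^ 2 :=
        add_nonneg (mul_nonneg (Nat.cast_nonneg _) (hi0.trans hY).le)
          (mul_nonneg hε.pos.le (by positivity))
      simp only at hd ⊢
      nlinarith [mul_pos (sub_pos.2 ha) hd, mul_nonneg (sub_pos.2 hY).le hc]
  · intro h
    refine lt_asymm (hS (m - 1) (by omega) (by omega))
      (turn_lt_turn_of_cross (him _) (him j) ?_)
    rw [slantedRay_cross]
    obtain ⟨n, rfl⟩ : ∃ n, m = n + 1 := ⟨m - 1, by omega⟩
    have hjn : ((j : ℕ) : ℝ) < n := by exact_mod_cast hj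
    have hj0 : (0 : ℝ) ≤ (j : ℕ) := Nat.cast_nonneg _
    simp only [Nat.add_sub_cancel, defect] at h ⊢
    push_cast at h
    refine mul_pos_of_neg_of_neg (sub_neg.2 hjn) ?_
    have hyx : x 1 ≤ x 0 := by linarith
    have hx0 : 0 < x 0 := by linarith
    have hb : (n + (j : ℕ) : ℝ) * x 1 + n * (j : ℕ) * x 0 <
        (2 * (n + 1) + (n + 1) ^ 2) * x 0 := by
      have e1 : (n + (j : ℕ) : ℝ) * x 1 ≤ (n + (j : ℕ)) * x 0 := by gcongr
      have e2 : (n : ℝ) * (j : ℕ) ≤ n * n := by gcongr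
      nlinarith
    nlinarith [mul_lt_mul_of_pos_left hb hε.pos]

theorem witness_mem_strip {m : ℕ} {ε : ℝ} (hε : IsSmall m ε) {i j : ℕ} (hi : i < m - 1)
    (hj : j < m) : witness m ε i j ∈ strip m ε i := by
  have hX := hε.one_lt_witness i hi j hj
  have hX0 : witness m ε i j 0 = witnessAbscissa m ε i j := by simp [witness, pt]
  have hY0 : witness m ε i j 1 = midSlope m i * witnessAbscissa m ε i j := by simp [witness, pt]
  have hμ := midSlope_pos m i
  have hμ1 := midSlope_lt_one (show i + 1 < m by omega)
  have hN : (1 + midSlope m i ^ 2) * witnessAbscissa m ε i j =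
      2 - ε * (2 * j * midSlope m i + j ^ 2) := by
    unfold witnessAbscissa
    field_simp
  have hjm : (j : ℝ) < m := by exact_mod_cast hj
  have hj0 : (0 : ℝ) ≤ j := Nat.cast_nonneg _
  have he : ε * (2 * j * midSlope m i + j ^ 2) < defect m ε := by
    refine mul_lt_mul_of_pos_left ?_ hε.pos
    nlinarith
  have he0 : 0 ≤ ε * (2 * j * midSlope m i + j ^ 2) := mul_nonneg hε.pos.le (by positivity)
  refine ⟨?_, ?_, ?_, ?_, ?_⟩
  · rw [hY0]; exact hε.height_lt_witness i hi j hj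
  · rw [hY0]; exact hε.witness_lt_height i hi j hj
  · rwa [hX0]
  · rw [hX0]; nlinarith
  · rw [hX0, hY0]; nlinarith

theorem le_card_connectedComponents_rreg {m : ℕ} {ε : ℝ} (hε : IsSmall m ε) {j : Fin m}
    (hj : (j : ℕ) < m - 1) : m - 1 ≤ Nat.card (ConnectedComponents
      (rreg (Finset.univ.map ⟨raySystem m ε, raySystem_injective hε⟩) (slantedRay ε j))) := by
  set A := rreg (Finset.univ.map ⟨raySystem m ε, raySystem_injective hε⟩) (slantedRay ε j)
  have hfin : Finite (ConnectedComponents A) := (finitelyPieced_rreg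
    (Finset.mem_map_of_mem ⟨raySystem m ε, raySystem_injective hε⟩ (Finset.mem_univ (Sum.inr j)))
    (raySystem_dir_ne_zero m ε (Sum.inr j))).finite_connectedComponents
  have hclopen : ∀ i < m - 1, IsClopen ((↑) ⁻¹' strip m ε i : Set A) := by
    intro i hi
    refine ⟨?_, (isOpen_strip m ε i).preimage continuous_subtype_val⟩
    convert (isClosed_closedStrip m ε i).preimage (continuous_subtype_val (p := (· ∈ A))) using 1
    exact Set.Subset.antisymm (fun x hx => strip_subset_closedStrip m ε i hx)
      fun x hx => mem_strip_of_mem_closedStrip hε hi hj x.2 hx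
  let f : Fin (m - 1) → ConnectedComponents A :=
    fun i => ((⟨witness m ε i j, witness_mem_rreg hε i.2 j⟩ : A) : ConnectedComponents A)
  have hf : Function.Injective f := by
    have key : ∀ i i' : Fin (m - 1), f i = f i' → witness m ε i' j ∈ strip m ε i := by
      intro i i' h
      have := (hclopen i i.2).connectedComponent_subset
        (show (⟨witness m ε i j, witness_mem_rreg hε i.2 j⟩ : A) ∈ _ from
          witness_mem_strip hε i.2 j.2)
      rw [ConnectedComponents.coe_eq_coe.1 h] at this
      exact this mem_connectedComponent
    intro i i' h
    by_contra hne
    wlog hlt : i < i' generalizing i i'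
    · exact this h.symm (Ne.symm hne) (lt_of_le_of_ne (not_lt.1 hlt) (Ne.symm hne))
    have h1 := (key i i' h).2.1
    have h2 := (witness_mem_strip hε i'.2 j.2).1
    have h3 := hε.height_le_height (show (i' : ℕ) < m by omega)
      (show (i : ℕ) + 1 ≤ i' from hlt)
    linarith
  simpa using Nat.card_le_card_of_injective f hf
/-- for every `m ≥ 2` there is a set of `2 m` pairwise disjoint rays whose
Voronoi regions have at least `(m - 1)²` connected components in total. -/
theorem stmt3 (m : ℕ) (hm : 2 ≤ m) :
    ∃ R : Finset Ray2, R.card = 2 * m ∧ (∀ r ∈ R, r.dir ≠ 0) ∧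
      (∀ r ∈ R, ∀ s ∈ R, r ≠ s → r.carrier ∩ s.carrier = ∅) ∧
      (m - 1) ^ 2 ≤ ∑ r ∈ R, Nat.card (ConnectedComponents ↥(rreg R r)) := by
  obtain ⟨ε, hε⟩ := (eventually_isSmall m).exists
  have hinj := raySystem_injective hε
  refine ⟨Finset.univ.map ⟨raySystem m ε, hinj⟩, by simp [two_mul], ?_, ?_, ?_⟩
  · intro r hr
    obtain ⟨p, -, rfl⟩ := Finset.mem_map.1 hr
    exact raySystem_dir_ne_zero m ε p
  · intro r hr s hs hrs
    obtain ⟨p, -, rfl⟩ := Finset.mem_map.1 hr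
    obtain ⟨q, -, rfl⟩ := Finset.mem_map.1 hs
    exact (disjoint_raySystem hε fun h => hrs (by rw [h])).inter_eq
  · obtain ⟨n, rfl⟩ : ∃ n, m = n + 1 := ⟨m - 1, by omega⟩
    rw [Finset.sum_map, Fintype.sum_sum_type]
    refine le_trans ?_ (Nat.le_add_left _ _)
    rw [Fin.sum_univ_castSucc]
    refine le_trans ?_ (Nat.le_add_right _ _)
    calc (n + 1 - 1) ^ 2 = ∑ _j : Fin n, (n + 1 - 1) := by simp [sq]
      _ ≤ _ := Finset.sum_le_sum fun j _ =>
        le_card_connectedComponents_rreg hε (j := j.castSucc) j.2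
end
end

section
/- Let R be a finite nonempty set of rays in the plane with pairwise distinct apices and pairwise linearly independent direction vectors (no two rays parallel or anti-parallel). Then the rotating rays Voronoi diagram RVD(R) = (ℝ² \ ⋃_{r ∈ R} rreg(r)) ∪ ⋃_{r ∈ R} r is a connected subset of ℝ². -/
noncomputable section

open Real

/-- A continuous function into the multiples of a real number is constant on preconnected sets. -/
lemma eq_of_sub_mem_zmultiples {X : Type*} [TopologicalSpace X] {S : Set X}
    (hS : IsPreconnected S) {c : ℝ} {g : X → ℝ} (hg : ContinuousOn g S) {x y : X} (hx : x ∈ S)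
    (hy : y ∈ S) (h : ∀ z ∈ S, g z ∈ AddSubgroup.zmultiples c) : g x = g y := by
  refine hS.constant_of_mapsTo (T := (AddSubgroup.zmultiples c : Set ℝ)) ?_ hg h hx hy
  rw [isDiscrete_iff_discreteTopology]
  exact inferInstanceAs (DiscreteTopology (AddSubgroup.zmultiples c))

/-- Unicoherence of simply connected spaces. -/
lemma IsPreconnected.inter_of_union_eq_univ {X : Type*} [TopologicalSpace X] [NormalSpace X]
    [SimplyConnectedSpace X] [LocallyPathConnectedSpace X] {K L : Set X}
    (hK : IsPreconnected K) (hL : IsPreconnected L) (hKc : IsClosed K) (hLc : IsClosed L)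
    (hKL : K ∪ L = Set.univ) : IsPreconnected (K ∩ L) := by
  classical
  rw [isPreconnected_iff_subset_of_fully_disjoint_closed (hKc.inter hLc)]
  intro A B hA hB hAB hdisj
  obtain ⟨f, hfA, hfB, -⟩ := exists_continuous_zero_one_of_isClosed hA hB hdisj
  have hval : ∀ x ∈ K ∩ L, ((f x : ℝ) : AddCircle (1 : ℝ)) = 0 := by
    intro x hx
    rcases hAB hx with h | h
    · simp [hfA h]
    · simp [hfB h]
  have hcont : Continuous fun x => if x ∈ K then (0 : AddCircle (1 : ℝ)) else (f x : ℝ) := by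
    rw [← continuousOn_univ, ← hKL]
    refine ContinuousOn.union_of_isClosed ?_ ?_ hKc hLc
    · exact continuousOn_const.congr fun x hx => if_pos hx
    · refine ((AddCircle.continuous_mk' (1 : ℝ)).comp f.continuous).continuousOn.congr
        fun x hx => ?_
      by_cases h : x ∈ K
      · exact (if_pos h).trans (hval x ⟨h, hx⟩).symm
      · exact if_neg h
  obtain ⟨x₀⟩ : Nonempty X := inferInstance
  obtain ⟨e₀, he₀⟩ := QuotientAddGroup.mk_surjective
    (if x₀ ∈ K then (0 : AddCircle (1 : ℝ)) else (f x₀ : ℝ))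
  obtain ⟨F, ⟨-, hF⟩, -⟩ := (AddCircle.isCoveringMap_coe (1 : ℝ)).existsUnique_continuousMap_lifts
    ⟨_, hcont⟩ x₀ e₀ he₀
  have hF' : ∀ x, ((F x : ℝ) : AddCircle (1 : ℝ)) = (if x ∈ K then (0 : AddCircle (1 : ℝ)) else (f x : ℝ)) :=
    fun x => congrFun hF x
  have hFK : ∀ x ∈ K, F x ∈ AddSubgroup.zmultiples (1 : ℝ) := by
    intro x hx
    rw [← QuotientAddGroup.eq_zero_iff]
    exact (hF' x).trans (if_pos hx)
  have hFL : ∀ x ∈ L, F x - f x ∈ AddSubgroup.zmultiples (1 : ℝ) := by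
    intro x hx
    rw [← QuotientAddGroup.eq_zero_iff]
    change ((F x - f x : ℝ) : AddCircle (1 : ℝ)) = 0
    rw [AddCircle.coe_sub, hF']
    split_ifs with h
    · rw [hval x ⟨h, hx⟩, sub_zero]
    · rw [sub_self]
  have hconst : ∀ x ∈ K ∩ L, ∀ y ∈ K ∩ L, f x = f y := by
    intro x hx y hy
    have h₁ := eq_of_sub_mem_zmultiples hK F.continuous.continuousOn hx.1 hy.1 hFK
    have h₂ := eq_of_sub_mem_zmultiples hL (g := fun x => F x - f x) (by fun_prop) hx.2 hy.2 hFL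
    linarith
  by_contra! hne
  obtain ⟨⟨x, hx, hxA⟩, ⟨y, hy, hyB⟩⟩ := And.imp Set.not_subset.1 Set.not_subset.1 hne
  have h := hconst x hx y hy
  rw [hfB ((hAB hx).resolve_left hxA), hfA ((hAB hy).resolve_right hyB)] at h
  simp at h

lemma isPreconnected_biInter_of_union_eq_univ {X ι : Type*} [TopologicalSpace X] [NormalSpace X]
    [SimplyConnectedSpace X] [LocallyPathConnectedSpace X] (K : ι → Set X) (S : Finset ι)
    (hK : ∀ i ∈ S, IsPreconnected (K i)) (hKc : ∀ i ∈ S, IsClosed (K i))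
    (hunion : ∀ i ∈ S, ∀ j ∈ S, i ≠ j → K i ∪ K j = Set.univ) :
    IsPreconnected (⋂ i ∈ S, K i) := by
  classical
  induction S using Finset.induction_on with
  | empty => simpa using isPreconnected_univ
  | insert a S ha ih =>
    rw [Finset.set_biInter_insert]
    simp only [Finset.mem_insert, forall_eq_or_imp] at hK hKc hunion
    refine hK.1.inter_of_union_eq_univ
      (ih hK.2 hKc.2 fun i hi j hj => (hunion.2 i hi).2 j hj) hKc.1
      (isClosed_biInter hKc.2) ?_
    rw [Set.union_iInter₂]
    refine Set.eq_univ_of_forall fun x => Set.mem_iInter₂.2 fun i hi => ?_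
    rw [hunion.1.2 i hi fun h => ha (h ▸ hi)]
    trivial

/-- The counterclockwise angle in `[0, 2π)` from the positive real axis. -/
def ccwArg (w : ℂ) : ℝ := angleIco (w.arg : Real.Angle)

lemma coe_ccwArg (w : ℂ) : (ccwArg w : Real.Angle) = w.arg := by
  unfold ccwArg angleIco
  split_ifs <;> simp

lemma ccwArg_eq_zero {w : ℂ} (hw : -w ∉ Complex.slitPlane) : ccwArg w = 0 := by
  have : w.arg = 0 := by
    rw [Complex.arg_eq_zero_iff]
    simpa [Complex.mem_slitPlane_iff, not_or] using hw
  simp [ccwArg, angleIco, this]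

lemma ccwArg_eq_arg_neg_add {w : ℂ} (hw : -w ∈ Complex.slitPlane) :
    ccwArg w = (-w).arg + π := by
  unfold ccwArg angleIco
  rw [Complex.arg_coe_angle_toReal_eq_arg]
  rw [Complex.mem_slitPlane_iff] at hw
  simp only [Complex.neg_re, Complex.neg_im, Left.neg_pos_iff, neg_ne_zero] at hw
  rcases lt_trichotomy w.im 0 with h | h | h
  · rw [if_neg (not_le.2 (Complex.arg_neg_iff.2 h)), Complex.arg_neg_eq_arg_add_pi_of_im_neg h]
    ring
  · have hre : w.re < 0 := by simpa [h] using hw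
    rw [if_pos (Complex.arg_nonneg_iff.2 h.ge),
      Complex.arg_neg_eq_arg_sub_pi_iff.2 (Or.inr ⟨h, hre⟩)]
    ring
  · rw [if_pos (Complex.arg_nonneg_iff.2 h.le), Complex.arg_neg_eq_arg_sub_pi_of_im_pos h]
    ring

lemma ccwArg_pos {w : ℂ} (hw : -w ∈ Complex.slitPlane) : 0 < ccwArg w := by
  rw [ccwArg_eq_arg_neg_add hw]
  linarith [Complex.neg_pi_lt_arg (-w)]

lemma ccwArg_nonneg (w : ℂ) : 0 ≤ ccwArg w := by
  by_cases hw : -w ∈ Complex.slitPlane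
  · exact (ccwArg_pos hw).le
  · exact (ccwArg_eq_zero hw).ge

lemma continuousAt_ccwArg {w : ℂ} (hw : -w ∈ Complex.slitPlane) : ContinuousAt ccwArg w := by
  have h : ContinuousAt (fun w : ℂ => (-w).arg + π) w :=
    ((Complex.continuousAt_arg hw).comp continuousAt_neg).add continuousAt_const
  refine h.congr ?_
  filter_upwards [(Complex.isOpen_slitPlane.preimage continuous_neg).mem_nhds hw] with z hz
  exact (ccwArg_eq_arg_neg_add hz).symm

/-- The identification of the plane with the complex numbers. -/
def toComplex : Pt ≃ₗᵢ[ℝ] ℂ := Complex.orthonormalBasisOneI.repr.symm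

lemma oangle_stdOrient (x y : Pt) :
    stdOrient.oangle x y = Complex.arg (starRingEnd ℂ (toComplex x) * toComplex y) := by
  refine Orientation.oangle_map_complex stdOrient toComplex ?_ x y
  rw [stdOrient, ← Module.Basis.orientation_map, Complex.orientation]
  congr 1

namespace Ray2

/-- The complex coordinate in which the ray is the nonnegative real axis. -/
def coord (r : Ray2) (x : Pt) : ℂ :=
  starRingEnd ℂ (toComplex r.dir) * (toComplex x - toComplex r.apex)

lemma continuous_coord (r : Ray2) : Continuous r.coord := by
  unfold coord
  fun_prop

lemma apex_mem_carrier_s9 (r : Ray2) : r.apex ∈ r.carrier := ⟨0, le_rfl, by simp⟩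

lemma isPreconnected_carrier (r : Ray2) : IsPreconnected r.carrier := by
  have : r.carrier = (fun t : ℝ => r.apex + t • r.dir) '' Set.Ici 0 := by
    ext x
    simp [carrier, eq_comm]
  rw [this]
  exact isPreconnected_Ici.image _ (by fun_prop)

lemma notMem_carrier_iff {r : Ray2} (hr : r.dir ≠ 0) (x : Pt) :
    x ∉ r.carrier ↔ -r.coord x ∈ Complex.slitPlane := by
  have hd : toComplex r.dir ≠ 0 := by simpa using hr
  have hd' : starRingEnd ℂ (toComplex r.dir) ≠ 0 := by simpa using hr
  have hn := Complex.normSq_pos.2 hd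
  have key : ∀ t : ℝ, x = r.apex + t • r.dir ↔
      r.coord x = (t * Complex.normSq (toComplex r.dir) : ℝ) := by
    intro t
    rw [← toComplex.injective.eq_iff, map_add, map_smul, coord, ← sub_eq_iff_eq_add',
      ← mul_right_inj' hd', Complex.real_smul]
    push_cast
    rw [← Complex.mul_conj]
    ring_nf
  have hmem : -r.coord x ∈ Complex.slitPlane ↔ ¬(0 ≤ (r.coord x).re ∧ (r.coord x).im = 0) := by
    rw [Complex.mem_slitPlane_iff]
    simp only [Complex.neg_re, Complex.neg_im, Left.neg_pos_iff, neg_ne_zero]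
    rw [not_and_or, not_le]
  rw [hmem, not_iff_not]
  constructor
  · rintro ⟨t, ht, h⟩
    rw [(key t).1 h]
    exact ⟨by rw [Complex.ofReal_re]; positivity, Complex.ofReal_im _⟩
  · rintro ⟨h₁, h₂⟩
    refine ⟨(r.coord x).re / Complex.normSq (toComplex r.dir), by positivity, (key _).2 ?_⟩
    rw [div_mul_cancel₀ _ hn.ne']
    exact Complex.ext (by simp) (by simp [h₂])

lemma isClosed_carrier (r : Ray2) : IsClosed r.carrier := by
  by_cases hr : r.dir = 0
  · have : r.carrier = {r.apex} := by
      ext x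
      simp only [carrier, hr, smul_zero, add_zero, Set.mem_ofPred_eq, Set.mem_singleton_iff]
      exact ⟨fun ⟨_, _, h⟩ => h, fun h => ⟨0, le_rfl, h⟩⟩
    rw [this]
    exact isClosed_singleton
  · rw [← isOpen_compl_iff]
    have : r.carrierᶜ = (fun x => -r.coord x) ⁻¹' Complex.slitPlane :=
      Set.ext fun x => notMem_carrier_iff hr x
    rw [this]
    exact Complex.isOpen_slitPlane.preimage r.continuous_coord.neg

end Ray2

lemma adist_eq (x : Pt) (r : Ray2) : adist x r = ccwArg (r.coord x) := by
  unfold adist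
  split_ifs with h
  · simp [h, Ray2.coord, ccwArg, angleIco]
  · rw [oangle_stdOrient, map_sub]
    rfl

open Ray2

lemma coe_adist (x : Pt) (r : Ray2) : (adist x r : Real.Angle) = (r.coord x).arg := by
  rw [adist_eq, coe_ccwArg]

lemma adist_nonneg (x : Pt) (r : Ray2) : 0 ≤ adist x r := by
  rw [adist_eq]
  exact ccwArg_nonneg _

lemma adist_of_mem_carrier {x : Pt} {r : Ray2} (hr : r.dir ≠ 0) (hx : x ∈ r.carrier) :
    adist x r = 0 := by
  rw [adist_eq]
  exact ccwArg_eq_zero fun h => (notMem_carrier_iff hr x).2 h hx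

lemma continuousAt_adist {x : Pt} {r : Ray2} (hr : r.dir ≠ 0) (hx : x ∉ r.carrier) :
    ContinuousAt (fun y => adist y r) x := by
  simp only [adist_eq]
  exact (continuousAt_ccwArg ((notMem_carrier_iff hr x).1 hx)).comp
    r.continuous_coord.continuousAt

/-- The ray `r` together with the points whose angular distance to `s` is at most that to `r`. -/
def farSide (r s : Ray2) : Set Pt := r.carrier ∪ {x | adist x s ≤ adist x r}

lemma carrier_subset_farSide {r s : Ray2} (hs : s.dir ≠ 0) : s.carrier ⊆ farSide r s :=
  fun x hx => Or.inr ((adist_of_mem_carrier hs hx).trans_le (adist_nonneg x r))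

/-- A path along which the difference of the angles to `s` and `r` is constant can be followed
inside `farSide r s` until it meets one of the two rays. -/
lemma exists_isPreconnected_subset_farSide {r s : Ray2} (hr : r.dir ≠ 0) (hs : s.dir ≠ 0)
    {γ : ℝ → Pt} (hγ : ContinuousOn γ (Set.Icc 0 1)) (h₀ : γ 0 ∈ r.carrier ∪ s.carrier)
    (h₁ : adist (γ 1) s ≤ adist (γ 1) r) {θ : Real.Angle}
    (hθ : ∀ t ∈ Set.Ioc (0 : ℝ) 1,
      ((s.coord (γ t)).arg : Real.Angle) - ((r.coord (γ t)).arg : Real.Angle) = θ) :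
    ∃ T ⊆ farSide r s, IsPreconnected T ∧ γ 1 ∈ T ∧ (T ∩ (r.carrier ∪ s.carrier)).Nonempty := by
  set S := Set.Icc (0 : ℝ) 1 ∩ γ ⁻¹' (r.carrier ∪ s.carrier)
  have hSc : IsCompact S := isCompact_Icc.of_isClosed_subset
    (hγ.preimage_isClosed_of_isClosed isClosed_Icc
      (r.isClosed_carrier.union s.isClosed_carrier)) Set.inter_subset_left
  obtain ⟨t₀, ht₀, hmax⟩ := hSc.exists_isGreatest ⟨0, ⟨le_rfl, zero_le_one⟩, h₀⟩
  have hsub : Set.Icc t₀ 1 ⊆ Set.Icc 0 1 := Set.Icc_subset_Icc_left ht₀.1.1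
  refine ⟨γ '' Set.Icc t₀ 1, ?_, isPreconnected_Icc.image _ (hγ.mono hsub),
    ⟨1, ⟨ht₀.1.2, le_rfl⟩, rfl⟩, γ t₀, ⟨t₀, ⟨le_rfl, ht₀.1.2⟩, rfl⟩, ht₀.2⟩
  rintro _ ⟨t, ht, rfl⟩
  rcases ht.1.eq_or_lt with rfl | hlt
  · exact ht₀.2.elim Or.inl fun h => carrier_subset_farSide hs h
  have hoff : ∀ z ∈ Set.Ioc t₀ 1, γ z ∉ r.carrier ∧ γ z ∉ s.carrier := fun z hz =>
    not_or.1 fun h => hz.1.not_ge (hmax ⟨hsub ⟨hz.1.le, hz.2⟩, h⟩)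
  have hsub' : Set.Ioc t₀ 1 ⊆ Set.Icc 0 1 := Set.Ioc_subset_Icc_self.trans hsub
  have hcont : ContinuousOn (fun z => adist (γ z) s - adist (γ z) r -
      (adist (γ 1) s - adist (γ 1) r)) (Set.Ioc t₀ 1) := by
    intro z hz
    have hγz := (hγ z (hsub' hz)).mono hsub'
    exact (((continuousAt_adist hs (hoff z hz).2).comp_continuousWithinAt hγz).sub
      ((continuousAt_adist hr (hoff z hz).1).comp_continuousWithinAt hγz)).sub
      continuousWithinAt_const
  have hmem : ∀ z ∈ Set.Ioc t₀ 1, adist (γ z) s - adist (γ z) r -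
      (adist (γ 1) s - adist (γ 1) r) ∈ AddSubgroup.zmultiples (2 * π) := by
    intro z hz
    rw [← QuotientAddGroup.eq_zero_iff]
    change ((_ : ℝ) : Real.Angle) = 0
    simp only [Real.Angle.coe_sub, coe_adist]
    rw [hθ z ⟨ht₀.1.1.trans_lt hz.1, hz.2⟩, hθ 1 ⟨zero_lt_one, le_rfl⟩, sub_self]
  have := eq_of_sub_mem_zmultiples isPreconnected_Ioc hcont ⟨hlt, ht.2⟩
    (⟨hlt.trans_le ht.2, le_rfl⟩ : (1 : ℝ) ∈ Set.Ioc t₀ 1) hmem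
  refine Or.inr (show adist (γ t) s ≤ adist (γ t) r from ?_)
  linarith

/-- For fixed `z`, these points trace the circle through the apices of `r` and `s` on which
the quotient of the positions relative to `s` and `r` has constant argument. -/
def circlePt (r s : Ray2) (z : ℂ) (a b : ℝ) : Pt :=
  toComplex.symm ((a * toComplex s.apex - b * z * toComplex r.apex) / (a - b * z))

section circlePt

variable {r s : Ray2} {z : ℂ} {a b : ℝ}

lemma circlePt_zero_right (h : a ≠ 0) : circlePt r s z a 0 = s.apex := by
  have : (a : ℂ) ≠ 0 := by exact_mod_cast h
  simp [circlePt, this]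

lemma circlePt_zero_left (hz : z ≠ 0) (h : b ≠ 0) : circlePt r s z 0 b = r.apex := by
  have : (b : ℂ) ≠ 0 := by exact_mod_cast h
  have e : (-(b * z * toComplex r.apex) / -(b * z) : ℂ) = toComplex r.apex := by
    field_simp
  simp [circlePt, e]

lemma continuousOn_circlePt {f g : ℝ → ℝ} (hf : Continuous f) (hg : Continuous g) {S : Set ℝ}
    (h : ∀ t ∈ S, (f t : ℂ) - g t * z ≠ 0) :
    ContinuousOn (fun t => circlePt r s z (f t) (g t)) S := by
  refine toComplex.symm.continuous.comp_continuousOn (ContinuousOn.div ?_ ?_ h) <;> fun_prop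

lemma arg_coord_circlePt (hrs : r.apex ≠ s.apex) (hr : r.dir ≠ 0) (hs : s.dir ≠ 0) (hz : z ≠ 0)
    (ha : 0 < a) (hb : 0 < b) (h : (a : ℂ) - b * z ≠ 0) :
    ((s.coord (circlePt r s z a b)).arg : Real.Angle) -
      ((r.coord (circlePt r s z a b)).arg : Real.Angle) =
    ((starRingEnd ℂ (toComplex s.dir) * z / starRingEnd ℂ (toComplex r.dir)).arg : ℝ) := by
  have hr' : starRingEnd ℂ (toComplex r.dir) ≠ 0 := by simpa using hr
  have hs' : starRingEnd ℂ (toComplex s.dir) ≠ 0 := by simpa using hs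
  have ha' : (a : ℂ) ≠ 0 := by exact_mod_cast ha.ne'
  have hb' : (b : ℂ) ≠ 0 := by exact_mod_cast hb.ne'
  have hpq : toComplex s.apex - toComplex r.apex ≠ 0 :=
    sub_ne_zero.2 fun e => hrs (toComplex.injective e).symm
  have es : s.coord (circlePt r s z a b) = starRingEnd ℂ (toComplex s.dir) *
      (b * z * (toComplex s.apex - toComplex r.apex) / (a - b * z)) := by
    rw [coord, circlePt, LinearIsometryEquiv.apply_symm_apply, div_sub' h]
    ring_nf
  have er : r.coord (circlePt r s z a b) = starRingEnd ℂ (toComplex r.dir) *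
      (a * (toComplex s.apex - toComplex r.apex) / (a - b * z)) := by
    rw [coord, circlePt, LinearIsometryEquiv.apply_symm_apply, div_sub' h]
    ring_nf
  rw [← Complex.arg_div_coe_angle, es, er, ← Complex.arg_real_mul
    (starRingEnd ℂ (toComplex s.dir) * z / starRingEnd ℂ (toComplex r.dir)) (div_pos hb ha)]
  · congr 2
    push_cast
    field_simp
  · rw [es]
    exact mul_ne_zero hs' (div_ne_zero (mul_ne_zero (mul_ne_zero hb' hz) hpq) h)
  · rw [er]
    exact mul_ne_zero hr' (div_ne_zero (mul_ne_zero ha' hpq) h)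

end circlePt

lemma adist_eq_of_arg_eq {x : Pt} {r s : Ray2}
    (h : ((s.coord x).arg : Real.Angle) = (r.coord x).arg) : adist x s = adist x r := by
  rw [adist_eq, adist_eq, ccwArg, ccwArg, h]

/-- Some circular arc in `farSide r s` joins the apices of `r` and `s`. -/
lemma exists_isPreconnected_apex_mem (r s : Ray2) (hrs : r.apex ≠ s.apex)
    (hdir : LinearIndependent ℝ ![r.dir, s.dir]) :
    ∃ T ⊆ farSide r s, IsPreconnected T ∧ r.apex ∈ T ∧ s.apex ∈ T := by
  have hr : r.dir ≠ 0 := hdir.ne_zero 0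
  have hs : s.dir ≠ 0 := hdir.ne_zero 1
  have hr' : starRingEnd ℂ (toComplex r.dir) ≠ 0 := by simpa using hr
  have hs' : starRingEnd ℂ (toComplex s.dir) ≠ 0 := by simpa using hs
  set z := starRingEnd ℂ (toComplex r.dir) / starRingEnd ℂ (toComplex s.dir) with hzdef
  have hz : z ≠ 0 := div_ne_zero hr' hs'
  have hne : ∀ t ∈ Set.Icc (0 : ℝ) 1, ((1 - t : ℝ) : ℂ) - t * z ≠ 0 := by
    intro t _ h
    rw [hzdef, ← mul_div_assoc, sub_eq_zero, eq_div_iff hs'] at h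
    have h' := congrArg (starRingEnd ℂ) h
    simp only [map_mul, Complex.conj_ofReal, Complex.conj_conj] at h'
    rw [← Complex.real_smul, ← Complex.real_smul, ← map_smul, ← map_smul,
      toComplex.injective.eq_iff] at h'
    have := LinearIndependent.pair_iff.1 hdir t (-(1 - t)) (by rw [neg_smul, h', add_neg_cancel])
    linarith [this.1, this.2]
  refine ⟨(fun t : ℝ => circlePt r s z (1 - t) t) '' Set.Icc 0 1, ?_,
    isPreconnected_Icc.image _ (continuousOn_circlePt (by fun_prop) continuous_id hne),
    ⟨1, by simp, ?_⟩, 0, by simp, ?_⟩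
  · rintro _ ⟨t, ht, rfl⟩
    rcases ht.1.eq_or_lt with rfl | h₀
    · simp only [sub_zero, circlePt_zero_right one_ne_zero]
      exact carrier_subset_farSide hs s.apex_mem_carrier_s9
    rcases ht.2.eq_or_lt with rfl | h₁
    · simp only [sub_self, circlePt_zero_left hz one_ne_zero]
      exact Or.inl r.apex_mem_carrier_s9
    refine Or.inr (adist_eq_of_arg_eq ?_).le
    rw [← sub_eq_zero, arg_coord_circlePt hrs hr hs hz (sub_pos.2 h₁) h₀ (hne t ht), hzdef,
      mul_div_cancel₀ _ hs', div_self hr', Complex.arg_one, Real.Angle.coe_zero]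
  · simp only [sub_self, circlePt_zero_left hz one_ne_zero]
  · simp only [sub_zero, circlePt_zero_right one_ne_zero]

lemma isPreconnected_farSide {r s : Ray2} (hrs : r.apex ≠ s.apex)
    (hdir : LinearIndependent ℝ ![r.dir, s.dir]) : IsPreconnected (farSide r s) := by
  have hr : r.dir ≠ 0 := hdir.ne_zero 0
  have hs : s.dir ≠ 0 := hdir.ne_zero 1
  obtain ⟨C, hCsub, hC, hrC, hsC⟩ := exists_isPreconnected_apex_mem r s hrs hdir
  set B := r.carrier ∪ C ∪ s.carrier
  have hBsub : B ⊆ farSide r s :=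
    Set.union_subset (Set.union_subset Set.subset_union_left hCsub) (carrier_subset_farSide hs)
  have hBconn : IsPreconnected B :=
    ((r.isPreconnected_carrier.union _ r.apex_mem_carrier_s9 hrC hC).union _ (Or.inr hsC)
      s.apex_mem_carrier_s9 s.isPreconnected_carrier)
  have hrB : r.apex ∈ B := Or.inl (Or.inl r.apex_mem_carrier_s9)
  have htail : ∀ x ∈ farSide r s, ∃ T ⊆ farSide r s, IsPreconnected T ∧ x ∈ T ∧
      (T ∩ (r.carrier ∪ s.carrier)).Nonempty := by
    intro x hx
    by_cases hxB : x ∈ r.carrier ∪ s.carrier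
    · exact ⟨{x}, by simpa using hx, isPreconnected_singleton, rfl, x, rfl, hxB⟩
    have hle : adist x s ≤ adist x r := hx.resolve_left fun h => hxB (Or.inl h)
    have hxr : toComplex x - toComplex r.apex ≠ 0 := sub_ne_zero.2 fun e =>
      hxB (Or.inl (toComplex.injective e ▸ r.apex_mem_carrier_s9))
    have hxs : toComplex x - toComplex s.apex ≠ 0 := sub_ne_zero.2 fun e =>
      hxB (Or.inr (toComplex.injective e ▸ s.apex_mem_carrier_s9))
    have hpq : toComplex s.apex - toComplex r.apex ≠ 0 :=
      sub_ne_zero.2 fun e => hrs (toComplex.injective e).symm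
    set z := (toComplex x - toComplex s.apex) / (toComplex x - toComplex r.apex) with hzdef
    have hz : z ≠ 0 := div_ne_zero hxs hxr
    have hz1 : 1 - z ≠ 0 := by
      rw [hzdef, one_sub_div hxr]
      exact div_ne_zero (by simpa using hpq) hxr
    have hx1 : circlePt r s z 1 1 = x := by
      rw [circlePt, LinearIsometryEquiv.symm_apply_eq, Complex.ofReal_one, one_mul, one_mul,
        div_eq_iff hz1, hzdef]
      field_simp
      ring
    have aux : ∀ f g : ℝ → ℝ, Continuous f → Continuous g → f 1 = 1 → g 1 = 1 →
        (∀ t ∈ Set.Ioc (0 : ℝ) 1, 0 < f t ∧ 0 < g t) →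
        (∀ t ∈ Set.Icc (0 : ℝ) 1, (f t : ℂ) - g t * z ≠ 0) →
        circlePt r s z (f 0) (g 0) ∈ r.carrier ∪ s.carrier →
        ∃ T ⊆ farSide r s, IsPreconnected T ∧ x ∈ T ∧
          (T ∩ (r.carrier ∪ s.carrier)).Nonempty := by
      intro f g hf hg hf1 hg1 hpos hne h₀
      have e : circlePt r s z (f 1) (g 1) = x := by rw [hf1, hg1, hx1]
      have := exists_isPreconnected_subset_farSide hr hs (continuousOn_circlePt hf hg hne) h₀
        (by simpa only [e] using hle) fun t ht => arg_coord_circlePt hrs hr hs hz (hpos t ht).1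
          (hpos t ht).2 (hne t (Set.Ioc_subset_Icc_self ht))
      simpa only [e] using this
    by_cases hreal : ∃ t ∈ Set.Icc (0 : ℝ) 1, (1 : ℂ) - t * z = 0
    · obtain ⟨t, ht, h⟩ := hreal
      refine aux (fun t => t) (fun _ => 1) continuous_id continuous_const rfl rfl
        (fun t ht => ⟨ht.1, one_pos⟩) (fun t' ht' h' => hz1 ?_) (Or.inl ?_)
      · have hz' : z = t' := by
          rw [Complex.ofReal_one, one_mul, sub_eq_zero] at h'
          exact h'.symm
        rw [hz'] at h ⊢
        norm_cast at h ⊢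
        nlinarith [ht.1, ht.2, ht'.1, ht'.2]
      · rw [circlePt_zero_left hz one_ne_zero]
        exact r.apex_mem_carrier_s9
    · push Not at hreal
      refine aux (fun _ => 1) (fun t => t) continuous_const continuous_id rfl rfl
        (fun t ht => ⟨one_pos, ht.1⟩) (by simpa using hreal) (Or.inr ?_)
      rw [circlePt_zero_right one_ne_zero]
      exact s.apex_mem_carrier_s9
  refine isPreconnected_of_forall r.apex fun x hx => ?_
  obtain ⟨T, hT, hTconn, hxT, y, hyT, hy⟩ := htail x hx
  refine ⟨B ∪ T, Set.union_subset hBsub hT, Or.inl hrB, Or.inr hxT,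
    hBconn.union y ?_ hyT hTconn⟩
  exact hy.elim (fun h => Or.inl (Or.inl h)) Or.inr

section regions

variable {R : Finset Ray2}

lemma compl_rreg_sdiff_carrier (R : Finset Ray2) (r : Ray2) :
    (rreg R r \ r.carrier)ᶜ = r.carrier ∪ ⋃ s ∈ R, ⋃ _ : s ≠ r, farSide r s := by
  ext x
  simp only [rreg, farSide, Set.mem_compl_iff, Set.mem_sdiff, Set.mem_ofPred_eq, Set.mem_union,
    Set.mem_iUnion, exists_prop]
  by_cases hx : x ∈ r.carrier
  · simp [hx]
  · simp [hx]

lemma isPreconnected_compl_rreg_sdiff_carrier {r : Ray2} (hr : r ∈ R)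
    (hapex : ∀ r ∈ R, ∀ s ∈ R, r ≠ s → r.apex ≠ s.apex)
    (hdir : ∀ r ∈ R, ∀ s ∈ R, r ≠ s → LinearIndependent ℝ ![r.dir, s.dir]) :
    IsPreconnected (rreg R r \ r.carrier)ᶜ := by
  rw [compl_rreg_sdiff_carrier]
  refine isPreconnected_of_forall r.apex fun x hx => ?_
  rcases hx with hx | hx
  · exact ⟨_, Set.subset_union_left, r.apex_mem_carrier_s9, hx, r.isPreconnected_carrier⟩
  · simp only [Set.mem_iUnion] at hx
    obtain ⟨s, hs, hsr, hx⟩ := hx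
    refine ⟨farSide r s, fun y hy => Or.inr ?_, Or.inl r.apex_mem_carrier_s9, hx,
      isPreconnected_farSide (hapex r hr s hs hsr.symm) (hdir r hr s hs hsr.symm)⟩
    simp only [Set.mem_iUnion]
    exact ⟨s, hs, hsr, hy⟩

lemma isClosed_farSide {r s : Ray2} (hr : r.dir ≠ 0) (hs : s.dir ≠ 0) :
    IsClosed (farSide r s) := by
  rw [← isOpen_compl_iff, isOpen_iff_mem_nhds]
  intro x hx
  have hxs : x ∉ s.carrier := fun h => hx (carrier_subset_farSide hs h)
  simp only [farSide, Set.mem_compl_iff, Set.mem_union, Set.mem_ofPred_eq, not_or, not_le] at hx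
  have hlt := (continuousAt_adist hr hx.1).eventually_lt (continuousAt_adist hs hxs) hx.2
  filter_upwards [hlt, r.isClosed_carrier.isOpen_compl.mem_nhds hx.1] with y hy hyr hmem
  exact hmem.elim hyr fun h => hy.not_ge h

lemma isClosed_compl_rreg_sdiff_carrier {r : Ray2} (hr : r ∈ R)
    (hdir : ∀ r ∈ R, ∀ s ∈ R, r ≠ s → LinearIndependent ℝ ![r.dir, s.dir]) :
    IsClosed (rreg R r \ r.carrier)ᶜ := by
  rw [compl_rreg_sdiff_carrier]
  refine r.isClosed_carrier.union (R.finite_toSet.isClosed_biUnion fun s hs =>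
    isClosed_iUnion_of_finite fun hsr => ?_)
  have h := hdir r hr s hs hsr.symm
  exact isClosed_farSide (h.ne_zero 0) (h.ne_zero 1)

lemma RVD_eq_biInter
    (hdir : ∀ r ∈ R, ∀ s ∈ R, r ≠ s → LinearIndependent ℝ ![r.dir, s.dir]) :
    RVD R = ⋂ r ∈ R, (rreg R r \ r.carrier)ᶜ := by
  ext x
  simp only [RVD, Set.mem_union, Set.mem_sdiff, Set.mem_univ, true_and, Set.mem_iUnion,
    exists_prop, Set.mem_iInter, Set.mem_compl_iff, not_and, not_not, not_exists]
  constructor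
  · rintro (h | ⟨s, hs, hxs⟩) r hr hx
    · exact absurd hx (h r hr)
    · by_contra hxr
      have hsr : s ≠ r := by
        rintro rfl
        exact hxr hxs
      have h := hx s hs hsr
      rw [adist_of_mem_carrier ((hdir s hs r hr hsr).ne_zero 0) hxs] at h
      exact h.not_ge (adist_nonneg x r)
  · intro h
    by_cases hx : ∃ r ∈ R, x ∈ r.carrier
    · exact Or.inr hx
    · push Not at hx
      exact Or.inl fun r hr hxr => hx r hr (h r hr hxr)

end regions

/-- the rotating rays Voronoi diagram of a finite nonempty set of rays with
pairwise distinct apices and pairwise linearly independent directions is connected. -/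
theorem stmt9 (R : Finset Ray2) (hR : R.Nonempty)
    (hapex : ∀ r ∈ R, ∀ s ∈ R, r ≠ s → r.apex ≠ s.apex)
    (hdir : ∀ r ∈ R, ∀ s ∈ R, r ≠ s → LinearIndependent ℝ ![r.dir, s.dir]) :
    IsConnected (RVD R) := by
  rw [RVD_eq_biInter hdir]
  constructor
  · obtain ⟨r, hr⟩ := hR
    rw [← RVD_eq_biInter hdir]
    refine ⟨r.apex, Or.inr ?_⟩
    simp only [Set.mem_iUnion]
    exact ⟨r, hr, r.apex_mem_carrier_s9⟩
  · refine isPreconnected_biInter_of_union_eq_univ _ R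
      (fun r hr => isPreconnected_compl_rreg_sdiff_carrier hr hapex hdir)
      (fun r hr => isClosed_compl_rreg_sdiff_carrier hr hdir) fun r hr s hs hrs => ?_
    rw [← Set.compl_inter, Set.compl_univ_iff]
    refine Set.eq_empty_of_forall_notMem fun x hx => ?_
    exact lt_asymm (hx.1.1 s hs hrs.symm) (hx.2.1 r hr hrs)
end
end

section
/- Let K ⊆ ℝ² be a closed convex set and let p ∈ ℝ² with p ∉ K. Call a point x ∈ frontier K visible from p if the open segment between p and x is disjoint from frontier K. Then for every circle S = Metric.sphere c ρ passing through p (i.e., with p ∈ S), the set { x ∈ S ∩ frontier K : x is visible from p } contains at most two points. -/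
noncomputable section

open Real

theorem norm_sq_convexCombo {E : Type*} [NormedAddCommGroup E] [InnerProductSpace ℝ E]
    (u v : E) (t : ℝ) :
    ‖(1 - t) • u + t • v‖ ^ 2 =
      (1 - t) * ‖u‖ ^ 2 + t * ‖v‖ ^ 2 - t * (1 - t) * ‖u - v‖ ^ 2 := by
  rw [norm_add_sq_real, norm_sub_sq_real, norm_smul, norm_smul, mul_pow, mul_pow,
    inner_smul_left, inner_smul_right, Real.norm_eq_abs, Real.norm_eq_abs, sq_abs, sq_abs]
  simp only [conj_trivial]
  ring

/-- If the inversion of `b` lies strictly between those of `a` and `d`, then the segment from the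
center `p` to `b` crosses the segment from `a` to `d` before reaching `b`. -/
theorem exists_mem_openSegment_of_sbtw_inversion {E : Type*} [NormedAddCommGroup E]
    [InnerProductSpace ℝ E] {p a b d : E} (ha : a ≠ p) (hb : b ≠ p) (hd : d ≠ p)
    (h : Sbtw ℝ (EuclideanGeometry.inversion p 1 a) (EuclideanGeometry.inversion p 1 b)
      (EuclideanGeometry.inversion p 1 d)) :
    ∃ q ∈ segment ℝ a d, q ∈ openSegment ℝ p b := by
  obtain ⟨t, ⟨ht0, ht1⟩, ht⟩ := h.mem_image_Ioo
  have hne := h.left_ne_right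
  have key : ∀ x : E, x ≠ p → ‖((1 / dist x p) ^ 2) • (x - p)‖ ^ 2 = (1 / dist x p) ^ 2 := by
    intro x hx
    have : ‖x - p‖ ≠ 0 := norm_ne_zero_iff.2 (sub_ne_zero.2 hx)
    rw [norm_smul, Real.norm_eq_abs, abs_of_nonneg (by positivity), dist_eq_norm]
    field_simp
  have hα := key a ha
  have hβ := key b hb
  have hδ := key d hd
  have hα0 : 0 < (1 / dist a p) ^ 2 := by have := dist_pos.2 ha; positivity
  have hβ0 : 0 < (1 / dist b p) ^ 2 := by have := dist_pos.2 hb; positivity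
  have hδ0 : 0 < (1 / dist d p) ^ 2 := by have := dist_pos.2 hd; positivity
  simp only [EuclideanGeometry.inversion, vsub_eq_sub, vadd_eq_add, ne_eq, add_left_inj,
    AffineMap.lineMap_apply, add_sub_add_right_eq_sub] at ht hne
  generalize (1 / dist a p) ^ 2 = α at *
  generalize (1 / dist b p) ^ 2 = β at *
  generalize (1 / dist d p) ^ 2 = δ at *
  have hcombo : β • (b - p) = (1 - t) • α • (a - p) + t • δ • (d - p) := by
    rw [← add_left_inj p, ← ht]
    module
  have hlt : β < (1 - t) * α + t * δ := by
    have hsq := norm_sq_convexCombo (α • (a - p)) (δ • (d - p)) t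
    rw [← hcombo, hα, hβ, hδ] at hsq
    have hpos : 0 < ‖α • (a - p) - δ • (d - p)‖ := norm_pos_iff.2 (sub_ne_zero.2 hne)
    have : 0 < t * (1 - t) * ‖α • (a - p) - δ • (d - p)‖ ^ 2 :=
      mul_pos (mul_pos ht0 (sub_pos.2 ht1)) (by positivity)
    linarith
  have h1t : 0 < 1 - t := sub_pos.2 ht1
  set N := (1 - t) * α + t * δ with hN
  have hN0 : 0 < N := hβ0.trans hlt
  refine ⟨(1 - β / N) • p + (β / N) • b, ⟨(1 - t) * α / N, t * δ / N, by positivity, by positivity,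
    by rw [← add_div, div_self hN0.ne'], ?_⟩,
    ⟨1 - β / N, β / N, sub_pos.2 ((div_lt_one hN0).2 hlt), by positivity, by ring, rfl⟩⟩
  have hsum : (1 - t) * α / N + t * δ / N = 1 := by rw [← add_div, div_self hN0.ne']
  calc ((1 - t) * α / N) • a + (t * δ / N) • d
      = N⁻¹ • ((1 - t) • α • (a - p) + t • δ • (d - p))
          + ((1 - t) * α / N + t * δ / N) • p := by module
    _ = (1 - β / N) • p + (β / N) • b := by
      rw [← hcombo, hsum]
      module

theorem segment_inter_frontier_nonempty {E : Type*} [AddCommGroup E] [Module ℝ E]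
    [TopologicalSpace E] [ContinuousAdd E] [ContinuousSMul ℝ E] {K : Set E} (hK : IsClosed K)
    {p q : E} (hp : p ∉ K) (hq : q ∈ K) : (segment ℝ p q ∩ frontier K).Nonempty := by
  by_contra hempty
  have hsub : segment ℝ p q ⊆ interior K ∪ Kᶜ := by
    intro x hx
    by_contra hxu
    simp only [Set.mem_union, Set.mem_compl_iff, not_or, not_not] at hxu
    exact hempty ⟨x, hx, hK.frontier_eq ▸ ⟨hxu.2, hxu.1⟩⟩
  have hqi : q ∈ interior K :=
    (hsub (right_mem_segment ℝ p q)).resolve_right (fun h => h hq)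
  have hseg : segment ℝ p q ⊆ interior K :=
    (convex_segment p q).isPreconnected.subset_left_of_subset_union isOpen_interior
      hK.isOpen_compl (Set.disjoint_compl_right_iff_subset.2 interior_subset) hsub
      ⟨q, right_mem_segment ℝ p q, hqi⟩
  exact hp (interior_subset (hseg (left_mem_segment ℝ p q)))

/-- No point of a closed set `K` lies before a point visible from `p ∉ K`. -/
theorem notMem_of_mem_openSegment_of_visible {E : Type*} [AddCommGroup E] [Module ℝ E]
    [TopologicalSpace E] [ContinuousAdd E] [ContinuousSMul ℝ E] {K : Set E} (hK : IsClosed K)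
    {p q x : E} (hp : p ∉ K) (hx : openSegment ℝ p x ∩ frontier K = ∅)
    (hq : q ∈ openSegment ℝ p x) : q ∉ K := by
  intro hqK
  obtain ⟨w, hw, hwK⟩ := segment_inter_frontier_nonempty hK hp hqK
  refine Set.eq_empty_iff_forall_notMem.1 hx w ⟨?_, hwK⟩
  have hwp : w ≠ p := fun h => hp (h ▸ hK.frontier_subset hwK)
  obtain ⟨a, b, ha, hb, hab, rfl⟩ := hq
  obtain ⟨r, s, hr, hs, hrs, rfl⟩ := hw
  have hs0 : 0 < s := by
    refine hs.lt_of_ne fun h => hwp ?_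
    subst h
    obtain rfl : r = 1 := by linarith
    simp
  refine ⟨r + s * a, s * b, by positivity, by positivity, ?_, by module⟩
  rw [← hrs, add_assoc, ← mul_add, hab, mul_one]

/-- In the plane, the inversion about a point of a circle maps the circle into a line. -/
theorem collinear_inversion_of_mem_sphere {E : Type*} [NormedAddCommGroup E]
    [InnerProductSpace ℝ E] [Fact (Module.finrank ℝ E = 2)] {p c : E} {ρ : ℝ}
    (hp : p ∈ Metric.sphere c ρ) {s : Set E} (hs : s ⊆ Metric.sphere c ρ \ {p}) :
    Collinear ℝ (EuclideanGeometry.inversion p 1 '' s) := by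
  have : FiniteDimensional ℝ E := .of_fact_finrank_eq_succ 1
  rcases eq_or_ne c p with rfl | hcp
  · obtain rfl : s = ∅ := by
      refine Set.eq_empty_of_forall_notMem fun x hx => (hs hx).2 ?_
      have := (hs hx).1
      rw [Metric.mem_sphere] at this hp
      rw [dist_self] at hp
      exact dist_eq_zero.1 (this.trans hp.symm)
    simpa using collinear_empty ℝ E
  set m := EuclideanGeometry.inversion p 1 c
  have hm : m -ᵥ p ≠ 0 :=
    vsub_ne_zero.2 fun h => hcp ((EuclideanGeometry.inversion_eq_center one_ne_zero).1 h)
  have hsub : EuclideanGeometry.inversion p 1 '' s ⊆ AffineSubspace.perpBisector p m := by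
    rintro _ ⟨x, hx, rfl⟩
    refine (EuclideanGeometry.inversion_mem_perpBisector_inversion_iff one_ne_zero
      (hs hx).2 hcp).2 ?_
    rw [Metric.mem_sphere.1 (hs hx).1, dist_comm, Metric.mem_sphere.1 hp]
  rw [collinear_iff_finrank_le_one]
  refine (Submodule.finrank_mono (vectorSpan_mono ℝ hsub)).trans ?_
  rw [← AffineSubspace.direction_eq_vectorSpan, AffineSubspace.direction_perpBisector,
    Submodule.finrank_orthogonal_span_singleton (n := 1) hm]

/-- a circle through a point `p` outside a closed convex set `K` meets the part
of the boundary of `K` visible from `p` in at most two points. -/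
theorem stmt16 (K : Set Pt) (hK : IsClosed K) (hconv : Convex ℝ K) (p : Pt) (hp : p ∉ K)
    (c : Pt) (ρ : ℝ) (hpS : p ∈ Metric.sphere c ρ) :
    ({x ∈ Metric.sphere c ρ ∩ frontier K |
        openSegment ℝ p x ∩ frontier K = ∅}).encard ≤ 2 := by
  by_contra hcard
  obtain ⟨t, hts, ht⟩ := Set.exists_subset_encard_eq (k := 3)
    (two_add_one_eq_three (R := ℕ∞) ▸ Order.add_one_le_of_lt (not_le.1 hcard))
  obtain ⟨x, y, z, hxy, hxz, hyz, rfl⟩ := Set.encard_eq_three.1 ht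
  have hKmem : ∀ w ∈ ({x, y, z} : Set Pt), w ∈ K := fun w hw =>
    hK.frontier_subset (hts hw).1.2
  have hne : ∀ w ∈ ({x, y, z} : Set Pt), w ≠ p := fun w hw h => hp (h ▸ hKmem w hw)
  have hcol := collinear_inversion_of_mem_sphere hpS
    (s := {x, y, z}) fun w hw => ⟨(hts hw).1.1, hne w hw⟩
  have hinj := EuclideanGeometry.inversion_injective p (one_ne_zero (α := ℝ))
  have hnot : ∀ a ∈ ({x, y, z} : Set Pt), ∀ b ∈ ({x, y, z} : Set Pt),
      ∀ d ∈ ({x, y, z} : Set Pt), b ≠ a → b ≠ d →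
      ¬ Wbtw ℝ (EuclideanGeometry.inversion p 1 a) (EuclideanGeometry.inversion p 1 b)
        (EuclideanGeometry.inversion p 1 d) := by
    intro a ha b hb d hd hba hbd hw
    obtain ⟨q, hq, hqb⟩ := exists_mem_openSegment_of_sbtw_inversion (hne a ha) (hne b hb)
      (hne d hd) ⟨hw, hinj.ne hba, hinj.ne hbd⟩
    exact notMem_of_mem_openSegment_of_visible hK hp (hts hb).2 hqb
      (hconv.segment_subset (hKmem a ha) (hKmem d hd) hq)
  rw [Set.image_insert_eq, Set.image_pair] at hcol
  rcases hcol.wbtw_or_wbtw_or_wbtw with h | h | h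
  · exact hnot x (by simp) y (by simp) z (by simp) hxy.symm hyz h
  · exact hnot y (by simp) z (by simp) x (by simp) hyz.symm hxz.symm h
  · exact hnot z (by simp) x (by simp) y (by simp) hxz hxy h
end
end
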